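/- arXiv:2104.06756 — 12 statements merged into one kernel-verified Lean document; each statement's English description precedes it below -/
import Mathlib

section
/- Let H be an n × n {±1} matrix with n ≥ 3 satisfying H·Hᵀ = n·Iₙ. Then n is divisible by 4. -/
open Matrix

/-- If `H` is an `n × n` `{±1}` matrix with `n ≥ 3` and `H * Hᵀ = n • I`,
then `4 ∣ n`. -/
theorem hadamard_order_div_four (n : ℕ) (hn : 3 ≤ n)
    (H : Matrix (Fin n) (Fin n) ℤ)
    (hent : ∀ i j, H i j = 1 ∨ H i j = -1)
    (hHad : H * Hᵀ = (n : ℤ) • 1) :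
    4 ∣ n := by
  have hcard : IsRegular (Fintype.card (Fin n) : ℤ) := by
    rw [Fintype.card_fin]
    exact IsRegular.of_ne_zero (by lia)
  have hH : H.IsHadamard := .of_mul_conjTranspose
    (fun i j => Unitary.mem_iff_eq_one_or_eq_neg_one.mpr (hent i j))
    (by rw [conjTranspose_eq_transpose_of_trivial, Fintype.card_fin, hHad]) hcard
  simpa using hH.four_dvd_card (by rw [Fintype.card_fin]; lia)
end

section
/- Let p be an odd prime and let Q be the Paley core of order p, i.e., the p × p integer matrix indexed by ℤ/pℤ with Q_{x,y} = χ(x−y), where χ is the quadratic character of ℤ/pℤ. Then (1) Q has all diagonal entries 0 and all off-diagonal entries in {1, −1}; (2) Q is circulant, i.e., Q_{x+1,y+1} = Q_{x,y} for all x, y; and (3) Q·Qᵀ = p·I − J, where I is the p × p identity matrix and J is the p × p all-ones matrix. -/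
open Matrix

/-- The correlation of the quadratic character with itself at two distinct shifts is `-1`. -/
theorem sum_quadraticChar_sub_mul_quadraticChar_sub_of_ne {F : Type*} [Field F] [Fintype F]
    [DecidableEq F] (hF : ringChar F ≠ 2) {x y : F} (hxy : x ≠ y) :
    ∑ z, quadraticChar F (x - z) * quadraticChar F (y - z) = -1 := by
  have hc : x - y ≠ 0 := sub_ne_zero.mpr hxy
  have hJ := jacobiSum_nontrivial_inv (quadraticChar_ne_one hF)
  rw [(quadraticChar_isQuadratic F).inv, jacobiSum] at hJ
  let e : F ≃ F := (Equiv.mulLeft₀ (x - y) hc).trans (Equiv.subLeft x)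
  have hterm (v : F) : quadraticChar F (x - e v) * quadraticChar F (y - e v) =
      quadraticChar F (-1) * (quadraticChar F v * quadraticChar F (1 - v)) := by
    have hx : x - e v = (x - y) * v := by simp [e]
    have hy : y - e v = -1 * (x - y) * (1 - v) := by simp [e]; ring
    rw [hx, hy]
    simp only [map_mul]
    linear_combination (quadraticChar F (-1) * quadraticChar F v * quadraticChar F (1 - v)) *
      quadraticChar_sq_one hc
  rw [← e.sum_comp, Finset.sum_congr rfl fun v _ => hterm v, ← Finset.mul_sum, hJ]
  linear_combination -quadraticChar_sq_one (neg_ne_zero.mpr (one_ne_zero (α := F)))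

/-- The correlation of the quadratic character with itself at equal shifts is `#F - 1`. -/
theorem sum_quadraticChar_sub_mul_self {F : Type*} [Field F] [Fintype F] [DecidableEq F] (x : F) :
    ∑ z, quadraticChar F (x - z) * quadraticChar F (x - z) = Fintype.card F - 1 := by
  have hterm (z : F) : quadraticChar F (x - z) * quadraticChar F (x - z) =
      1 - if x = z then 1 else 0 := by
    split_ifs with h
    · simp [h]
    · rw [← sq, quadraticChar_sq_one (sub_ne_zero.mpr h), sub_zero]
  simp_rw [hterm]
  simp

/-- Properties of the Paley core matrix `Q` of odd prime order `p`:
zero diagonal, `±1` off-diagonal entries, circulant, and `Q * Qᵀ = p • I - J`. -/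
theorem paley_core_properties (p : ℕ) [Fact p.Prime] (hp : Odd p)
    (Q : Matrix (ZMod p) (ZMod p) ℤ)
    (hQ : ∀ x y, Q x y = quadraticChar (ZMod p) (x - y)) :
    (∀ x, Q x x = 0) ∧
    (∀ x y, x ≠ y → Q x y = 1 ∨ Q x y = -1) ∧
    (∀ x y, Q (x + 1) (y + 1) = Q x y) ∧
    Q * Qᵀ = (p : ℤ) • (1 : Matrix (ZMod p) (ZMod p) ℤ) - Matrix.of (fun _ _ => 1) := by
  have hF : ringChar (ZMod p) ≠ 2 := by
    rw [ZMod.ringChar_zmod_n]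
    rintro rfl
    exact absurd hp (by decide)
  refine ⟨fun x => by simp [hQ], fun x y hxy => ?_, fun x y => by simp [hQ], ?_⟩
  · rw [hQ]
    exact quadraticChar_dichotomy (sub_ne_zero.mpr hxy)
  · ext x y
    simp only [mul_apply, transpose_apply, hQ, Matrix.sub_apply, Matrix.smul_apply, of_apply]
    obtain rfl | hxy := eq_or_ne x y
    · rw [sum_quadraticChar_sub_mul_self, ZMod.card, one_apply_eq, smul_eq_mul, mul_one]
    · rw [sum_quadraticChar_sub_mul_quadraticChar_sub_of_ne hF hxy, one_apply_ne hxy, smul_zero,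
        zero_sub]
end

section
/- Let B be a real symmetric positive definite matrix of size (k+1) × (k+1) whose first k diagonal entries all equal m, whose bottom-right entry equals b, and whose last-column entries b₁, …, b_k (above the bottom-right entry) satisfy 0 < b ≤ |bᵢ| for all 1 ≤ i ≤ k. Then det(B) ≤ b·(m−b)^k. -/
open Matrix

/-- The AM-GM inequality for the eigenvalues of a positive semidefinite matrix with bounded
diagonal. -/
theorem Matrix.PosSemidef.det_le_pow_card {n : Type*} [Fintype n] [DecidableEq n]
    {S : Matrix n n ℝ} (hS : S.PosSemidef) {c : ℝ} (hc : ∀ i, S i i ≤ c) :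
    S.det ≤ c ^ Fintype.card n := by
  rcases isEmpty_or_nonempty n with hn | hn
  · simp
  have hcard : (0 : ℝ) < Fintype.card n := by exact_mod_cast Fintype.card_pos
  have hdet : S.det = ∏ i, hS.isHermitian.eigenvalues i := by
    simpa using hS.isHermitian.det_eq_prod_eigenvalues
  have htr : S.trace = ∑ i, hS.isHermitian.eigenvalues i := by
    simpa using hS.isHermitian.trace_eq_sum_eigenvalues
  have hamgm := Real.geom_mean_le_arith_mean Finset.univ (fun _ : n => (1 : ℝ))
    hS.isHermitian.eigenvalues (by simp) (by simpa using hcard)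
    (fun i _ => hS.eigenvalues_nonneg i)
  simp only [Real.rpow_one, one_mul, Finset.sum_const, Finset.card_univ, nsmul_eq_mul,
    mul_one, ← hdet, ← htr] at hamgm
  have htrace : S.trace ≤ Fintype.card n * c := by
    simpa [Matrix.trace] using Finset.sum_le_sum fun i (_ : i ∈ Finset.univ) => hc i
  calc S.det = (S.det ^ ((Fintype.card n : ℝ)⁻¹)) ^ Fintype.card n :=
        (Real.rpow_inv_natCast_pow hS.det_nonneg Fintype.card_ne_zero).symm
    _ ≤ c ^ Fintype.card n := by
        refine pow_le_pow_left₀ (Real.rpow_nonneg hS.det_nonneg _) (hamgm.trans ?_) _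
        rwa [div_le_iff₀ hcard, mul_comm c]

/-- Wojtas' lemma: if `B` is a real symmetric positive definite `(k+1) × (k+1)`
matrix whose first `k` diagonal entries equal `m`, whose bottom-right entry is `b`,
and whose last-column entries `bᵢ` satisfy `0 < b ≤ |bᵢ|`, then
`det B ≤ b * (m - b)^k`. -/
theorem wojtas_lemma (k : ℕ) (m b : ℝ)
    (B : Matrix (Fin (k + 1)) (Fin (k + 1)) ℝ)
    (hB : B.PosDef)
    (hdiag : ∀ i : Fin k, B i.castSucc i.castSucc = m)
    (hcorner : B (Fin.last k) (Fin.last k) = b)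
    (hbpos : 0 < b)
    (hcol : ∀ i : Fin k, b ≤ |B i.castSucc (Fin.last k)|) :
    B.det ≤ b * (m - b) ^ k := by
  let A : Matrix (Fin k) (Fin k) ℝ := B.submatrix Fin.castSucc Fin.castSucc
  let C : Matrix (Fin k) (Fin 1) ℝ := B.submatrix Fin.castSucc fun _ => Fin.last k
  let D : Matrix (Fin 1) (Fin 1) ℝ := Matrix.diagonal fun _ => b
  have hsymm : ∀ i j, B i j = B j i := fun i j => by simpa using (hB.isHermitian.apply i j).symm
  have hblocks : B.submatrix finSumFinEquiv finSumFinEquiv = fromBlocks A C Cᴴ D := by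
    ext (i | i) (j | j)
    · rfl
    · fin_cases j; rfl
    · fin_cases i; exact hsymm _ _
    · fin_cases i; fin_cases j; exact hcorner
  have hD : D.PosDef := Matrix.PosDef.diagonal fun _ => hbpos
  let _ : Invertible D := hD.isUnit.invertible
  have hS : (A - C * D⁻¹ * Cᴴ).PosSemidef :=
    (Matrix.PosDef.fromBlocks₂₂ A C hD).1 (hblocks ▸ hB.posSemidef.submatrix _)
  have hdet : B.det = b * (A - C * D⁻¹ * Cᴴ).det := by
    rw [← det_submatrix_equiv_self finSumFinEquiv B, hblocks, det_fromBlocks₂₂, invOf_eq_nonsing_inv]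
    simp [D]
  have hle : ∀ i, (A - C * D⁻¹ * Cᴴ) i i ≤ m - b := by
    intro i
    have hi : (A - C * D⁻¹ * Cᴴ) i i = m - B i.castSucc (Fin.last k) ^ 2 / b := by
      simp [Matrix.mul_apply, A, C, D, hdiag, inv_subsingleton]
      ring
    have hsq : b ^ 2 ≤ B i.castSucc (Fin.last k) ^ 2 := by
      rw [← sq_abs (B _ _)]
      exact pow_le_pow_left₀ hbpos.le (hcol i) 2
    rw [hi, sub_le_sub_iff_left, le_div_iff₀ hbpos]
    nlinarith
  rw [hdet]
  exact mul_le_mul_of_nonneg_left (by simpa using hS.det_le_pow_card hle) hbpos.le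
end

section
/- Let G be an n × n real symmetric positive definite matrix with all diagonal entries equal to n, and suppose |g_{i,j}| ≥ b > 0 for all off-diagonal entries (i ≠ j). If det(G) = (n + (n−1)·b)·(n − b)^(n−1), then there exist a permutation matrix P and a diagonal matrix D with diagonal entries in {1, −1} such that (D·P)·G·(D·P)ᵀ = (n − b)·I + b·J, where I is the identity and J the all-ones matrix of order n. -/
open Matrix

/-- The equality case of `det M ≤ 1` for positive semidefinite matrices whose diagonal is
bounded by `1`. -/
theorem Matrix.PosSemidef.eq_one_of_one_le_det {ι : Type*} [Fintype ι] [DecidableEq ι]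
    {M : Matrix ι ι ℝ} (hM : M.PosSemidef) (hdiag : ∀ i, M i i ≤ 1) (hdet : 1 ≤ M.det) :
    M = 1 := by
  have hH := hM.isHermitian
  have hpd : M.PosDef := hM.posDef_iff_det_ne_zero.mpr (by linarith)
  have hpos : ∀ i, 0 < hH.eigenvalues i := hpd.eigenvalues_pos
  have htr : ∑ i, (hH.eigenvalues i - 1) ≤ 0 := by
    have h : M.trace = ∑ i, hH.eigenvalues i := hH.trace_eq_sum_eigenvalues
    rw [Finset.sum_sub_distrib, ← h, Matrix.trace, ← Finset.sum_sub_distrib]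
    exact Finset.sum_nonpos fun i _ => by simpa using hdiag i
  have hlog : 0 ≤ ∑ i, Real.log (hH.eigenvalues i) := by
    have h : M.det = ∏ i, hH.eigenvalues i := hH.det_eq_prod_eigenvalues
    rw [← Real.log_prod fun i _ => (hpos i).ne', ← h]
    exact Real.log_nonneg hdet
  have hone : ∀ i, hH.eigenvalues i = 1 := by
    by_contra! ⟨j, hj⟩
    have : ∑ i, Real.log (hH.eigenvalues i) < ∑ i, (hH.eigenvalues i - 1) :=
      Finset.sum_lt_sum (fun i _ => Real.log_le_sub_one_of_pos (hpos i))
        ⟨j, Finset.mem_univ j, Real.log_lt_sub_one_of_pos (hpos j) hj⟩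
    linarith
  have hspec := hH.spectral_theorem
  rw [show hH.eigenvalues = fun _ => 1 from funext hone] at hspec
  simpa [Function.comp_def] using hspec

/-- The equality case of `det M ≤ c ^ card ι` for positive semidefinite matrices whose diagonal is
bounded by `c`. -/
theorem Matrix.PosSemidef.eq_smul_one_of_pow_le_det {ι : Type*} [Fintype ι] [DecidableEq ι]
    {M : Matrix ι ι ℝ} (hM : M.PosSemidef) {c : ℝ} (hc : 0 < c) (hdiag : ∀ i, M i i ≤ c)
    (hdet : c ^ Fintype.card ι ≤ M.det) : M = c • (1 : Matrix ι ι ℝ) := by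
  have h : c⁻¹ • M = 1 := by
    refine (hM.smul (inv_pos.mpr hc).le).eq_one_of_one_le_det (fun i => ?_) ?_
    · rw [smul_apply, smul_eq_mul, inv_mul_le_one₀ hc]
      exact hdiag i
    · rw [det_smul, inv_pow, inv_mul_eq_div, one_le_div₀ (by positivity)]
      exact hdet
  rw [← h, smul_inv_smul₀ hc.ne']

theorem Matrix.det_fromBlocks_diagonal_fin_one {ι : Type*} [Fintype ι] [DecidableEq ι]
    (A : Matrix ι ι ℝ) (hA : IsUnit A) (V : Matrix ι (Fin 1) ℝ) (W : Matrix (Fin 1) ι ℝ) (c : ℝ) :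
    (fromBlocks A V W (diagonal fun _ => c)).det = A.det * (c - (W * A⁻¹ * V) 0 0) := by
  have := hA.invertible
  simp [det_fromBlocks₁₁]

/-- If the diagonal of `A` is `a` and the entries of `V` are at least `b` in absolute value, then the
bordered matrix `[A, V; Vᴴ, a]` has determinant at least `(a - b) * det A + b * (a - b) ^ card ι` only
in the equality case, where the Schur complement of `b` in `[A, V; Vᴴ, b]` is `(a - b) • 1`. -/
theorem Matrix.PosDef.schur_eq_smul_one_of_le_det_fromBlocks {ι : Type*} [Fintype ι] [DecidableEq ι]
    {A : Matrix ι ι ℝ} (hA : A.PosDef) (V : Matrix ι (Fin 1) ℝ) {a b : ℝ} (hb : 0 < b)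
    (hab : b < a) (hdiag : ∀ i, A i i = a) (hV : ∀ i, b ≤ |V i 0|)
    (hdet : (a - b) * A.det + b * (a - b) ^ Fintype.card ι ≤
      (fromBlocks A V Vᴴ (diagonal fun _ => a)).det) :
    A - b⁻¹ • (V * Vᴴ) = (a - b) • (1 : Matrix ι ι ℝ) ∧
      (fromBlocks A V Vᴴ (diagonal fun _ => a)).det =
        (a - b) * A.det + b * (a - b) ^ Fintype.card ι := by
  set S := A - b⁻¹ • (V * Vᴴ) with hS
  have hD : (diagonal fun _ : Fin 1 => b).PosDef := .diagonal fun _ => hb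
  have := hA.isUnit.invertible
  have := hD.isUnit.invertible
  have hDinv : (diagonal fun _ : Fin 1 => b)⁻¹ = b⁻¹ • (1 : Matrix (Fin 1) (Fin 1) ℝ) := by
    ext i j
    simp [Subsingleton.elim i 0, Subsingleton.elim j 0]
  have hSschur : A - V * (diagonal fun _ : Fin 1 => b)⁻¹ * Vᴴ = S := by
    rw [hDinv, Matrix.mul_smul, Matrix.mul_one, Matrix.smul_mul]
  have hc : 0 < a - b := sub_pos.mpr hab
  have hab_det := det_fromBlocks_diagonal_fin_one A hA.isUnit V Vᴴ a
  have hbb_det := det_fromBlocks_diagonal_fin_one A hA.isUnit V Vᴴ b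
  have hSdet : (fromBlocks A V Vᴴ (diagonal fun _ => b)).det = b * S.det := by
    rw [det_fromBlocks₂₂, invOf_eq_nonsing_inv, hSschur]
    simp
  have hpow : (a - b) ^ Fintype.card ι ≤ S.det :=
    le_of_mul_le_mul_left (by linarith) hb
  have hSpos : S.PosSemidef := by
    rw [← hSschur, ← PosDef.fromBlocks₂₂ A V hD, PosDef.fromBlocks₁₁ V _ hA]
    have hs : 0 ≤ b - (Vᴴ * A⁻¹ * V) 0 0 := by
      refine ((mul_pos_iff_of_pos_left hA.det_pos).mp ?_).le
      rw [← hbb_det, hSdet]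
      exact mul_pos hb ((pow_pos hc _).trans_le hpow)
    have : diagonal (fun _ => b) - Vᴴ * A⁻¹ * V =
        diagonal fun _ : Fin 1 => b - (Vᴴ * A⁻¹ * V) 0 0 := by
      ext i j
      fin_cases i; fin_cases j
      simp
    rw [this]
    exact .diagonal fun _ => hs
  have hSone : S = (a - b) • (1 : Matrix ι ι ℝ) := by
    refine hSpos.eq_smul_one_of_pow_le_det hc (fun i => ?_) hpow
    have hVi : b ≤ V i 0 * b⁻¹ * V i 0 := by
      have h : b ^ 2 ≤ V i 0 ^ 2 := sq_le_sq.mpr (by simpa [abs_of_pos hb] using hV i)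
      field_simp
      exact h
    have : S i i = a - V i 0 * b⁻¹ * V i 0 := by
      simp [hS, Matrix.mul_apply, hdiag]
      ring
    linarith
  refine ⟨hSone, ?_⟩
  have : S.det = (a - b) ^ Fintype.card ι := by rw [hSone]; simp
  rw [this] at hSdet
  linarith

theorem Matrix.PosDef.eq_fromBlocks_fin_one {ι : Type*} [Fintype ι] [DecidableEq ι]
    {H : Matrix (ι ⊕ Fin 1) (ι ⊕ Fin 1) ℝ} (hH : H.PosDef) {a : ℝ}
    (hdiag : ∀ i, H i i = a) :
    H = fromBlocks H.toBlocks₁₁ H.toBlocks₁₂ H.toBlocks₁₂ᴴ (diagonal fun _ => a) := by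
  ext (i | i) (j | j)
  · rfl
  · rfl
  · simpa [toBlocks₁₂] using (hH.isHermitian.apply (Sum.inr i) (Sum.inl j)).symm
  · simp [Subsingleton.elim i 0, Subsingleton.elim j 0, hdiag]

/-- The Ehlich–Wojtas bound. -/
theorem Matrix.PosDef.det_le_ehlich_wojtas {a b : ℝ} (hb : 0 < b) (hab : b < a) (k : ℕ)
    {G : Matrix (Fin (k + 1)) (Fin (k + 1)) ℝ} (hG : G.PosDef) (hdiag : ∀ i, G i i = a)
    (hoff : ∀ i j, i ≠ j → b ≤ |G i j|) :
    G.det ≤ (a + k * b) * (a - b) ^ k := by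
  induction k with
  | zero => simp [hdiag]
  | succ k ih =>
    let e : Fin (k + 1) ⊕ Fin 1 ≃ Fin (k + 1 + 1) := finSumFinEquiv
    have hH : (G.submatrix e e).PosDef := hG.submatrix e.injective
    have hblocks := hH.eq_fromBlocks_fin_one (a := a) (fun i => hdiag (e i))
    have hA : (G.submatrix e e).toBlocks₁₁.PosDef := hH.submatrix Sum.inl_injective
    have hAdet := ih hA (fun i => hdiag _)
      (fun i j hij => hoff _ _ (e.injective.ne (Sum.inl_injective.ne hij)))
    have hle : G.det ≤ (a - b) * (G.submatrix e e).toBlocks₁₁.det + b * (a - b) ^ (k + 1) := by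
      by_contra! hlt
      rw [← det_submatrix_equiv_self e G, hblocks] at hlt
      have := (hA.schur_eq_smul_one_of_le_det_fromBlocks _ hb hab (fun i => hdiag _)
        (fun i => hoff _ _ (e.injective.ne Sum.inl_ne_inr)) (by simpa using hlt.le)).2
      simp at this hlt
      linarith
    have := mul_le_mul_of_nonneg_left hAdet (sub_pos.mpr hab).le
    refine hle.trans ?_
    push_cast
    linear_combination this

/-- Equality in the Ehlich–Wojtas bound forces all off-diagonal entries to be `±b`, with signs
coming from a vector. -/
theorem Matrix.PosDef.exists_signs_of_ehlich_wojtas_le_det {a b : ℝ} (hb : 0 < b) (hab : b < a)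
    (k : ℕ) {G : Matrix (Fin (k + 2)) (Fin (k + 2)) ℝ} (hG : G.PosDef)
    (hdiag : ∀ i, G i i = a) (hoff : ∀ i j, i ≠ j → b ≤ |G i j|)
    (hdet : (a + (k + 1) * b) * (a - b) ^ (k + 1) ≤ G.det) :
    ∃ d : Fin (k + 2) → ℝ, (∀ i, d i = 1 ∨ d i = -1) ∧
      ∀ i j, i ≠ j → G i j = d i * d j * b := by
  let e : Fin (k + 1) ⊕ Fin 1 ≃ Fin (k + 2) := finSumFinEquiv
  set H := G.submatrix e e with hHdef
  have hH : H.PosDef := hG.submatrix e.injective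
  have hblocks := hH.eq_fromBlocks_fin_one (a := a) (fun i => hdiag (e i))
  have hA : H.toBlocks₁₁.PosDef := hH.submatrix Sum.inl_injective
  have hAdet := hA.det_le_ehlich_wojtas hb hab k (fun i => hdiag _)
    (fun i j hij => hoff _ _ (e.injective.ne (Sum.inl_injective.ne hij)))
  have hS := (hA.schur_eq_smul_one_of_le_det_fromBlocks H.toBlocks₁₂ hb hab (fun i => hdiag _)
    (fun i => hoff _ _ (e.injective.ne Sum.inl_ne_inr)) (by
      rw [← hblocks, hHdef, det_submatrix_equiv_self, Fintype.card_fin]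
      have := mul_le_mul_of_nonneg_left hAdet (sub_pos.mpr hab).le
      linear_combination this + hdet)).1
  have hentry : ∀ i j, H (.inl i) (.inl j) - b⁻¹ * (H (.inl i) (.inr 0) * H (.inl j) (.inr 0)) =
      (a - b) * (1 : Matrix (Fin (k + 1)) (Fin (k + 1)) ℝ) i j := by
    intro i j
    have := congrFun (congrFun hS i) j
    simpa [Matrix.mul_apply, toBlocks₁₁, toBlocks₁₂] using this
  let d : Fin (k + 1) ⊕ Fin 1 → ℝ := Sum.elim (fun i => H (.inl i) (.inr 0) / b) (fun _ => 1)
  have hd : ∀ i, d i = 1 ∨ d i = -1 := by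
    rintro (i | i)
    · have h := hentry i i
      rw [one_apply_eq, show H (.inl i) (.inl i) = a from hdiag _] at h
      rw [← sq_eq_one_iff]
      simp only [d, Sum.elim_inl]
      field_simp at h ⊢
      linarith
    · exact .inl rfl
  have hmain : ∀ i j, i ≠ j → H i j = d i * d j * b := by
    rintro (i | i) (j | j) hij
    · have h := hentry i j
      rw [one_apply_ne fun h => hij (congrArg _ h)] at h
      simp only [d, Sum.elim_inl]
      field_simp at h ⊢
      linarith
    · simp [d, Subsingleton.elim j 0, hb.ne']
    · have h : H (.inr i) (.inl j) = H (.inl j) (.inr i) := by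
        simpa using (hH.isHermitian.apply (.inr i) (.inl j)).symm
      rw [h]
      simp [d, Subsingleton.elim i 0, hb.ne']
    · exact absurd (congrArg _ (Subsingleton.elim i j)) hij
  refine ⟨d ∘ e.symm, fun i => hd _, fun i j hij => ?_⟩
  simpa [hHdef] using hmain (e.symm i) (e.symm j) (e.symm.injective.ne hij)

theorem Matrix.PosDef.abs_apply_lt {ι : Type*} [Fintype ι] [DecidableEq ι]
    {G : Matrix ι ι ℝ} (hG : G.PosDef) {a : ℝ} (hdiag : ∀ i, G i i = a) {i j : ι} (hij : i ≠ j) :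
    |G i j| < a := by
  have hf : Function.Injective ![i, j] := by
    intro x y
    fin_cases x <;> fin_cases y <;> simp [hij, hij.symm]
  have h := (hG.submatrix hf).det_pos
  have ha : 0 < a := hdiag i ▸ hG.diag_pos
  have hsymm : G j i = G i j := by simpa using hG.isHermitian.apply i j
  simp only [det_fin_two, submatrix_apply, cons_val_zero, cons_val_one, hdiag, hsymm] at h
  exact abs_lt_of_sq_lt_sq (by linarith) ha.le

/-- Characterisation of equality in the Ehlich–Wojtas bound: if `G` is an `n × n`
real symmetric positive definite matrix with all diagonal entries equal to `n`,
`|g i j| ≥ b > 0` off the diagonal, and `det G = (n + (n-1)b)(n-b)^(n-1)`, then up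
to conjugation by a signed permutation matrix `D * P`, `G = (n - b) • I + b • J`. -/
theorem ehlich_wojtas_equality_case (n : ℕ) (b : ℝ)
    (G : Matrix (Fin n) (Fin n) ℝ)
    (hG : G.PosDef)
    (hdiag : ∀ i, G i i = (n : ℝ))
    (hbpos : 0 < b)
    (hoff : ∀ i j, i ≠ j → b ≤ |G i j|)
    (hdet : G.det = ((n : ℝ) + ((n : ℝ) - 1) * b) * ((n : ℝ) - b) ^ (n - 1)) :
    ∃ σ : Equiv.Perm (Fin n), ∃ d : Fin n → ℝ, (∀ i, d i = 1 ∨ d i = -1) ∧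
      (Matrix.diagonal d * σ.permMatrix ℝ) * G * (Matrix.diagonal d * σ.permMatrix ℝ)ᵀ
        = ((n : ℝ) - b) • (1 : Matrix (Fin n) (Fin n) ℝ)
          + b • Matrix.of (fun _ _ => 1) := by
  obtain ⟨d, hd, hGd⟩ : ∃ d : Fin n → ℝ, (∀ i, d i = 1 ∨ d i = -1) ∧
      ∀ i j, i ≠ j → G i j = d i * d j * b := by
    match n with
    | 0 => exact ⟨1, fun i => i.elim0, fun i => i.elim0⟩
    | 1 => exact ⟨1, fun i => .inl rfl, fun i j hij => absurd (Subsingleton.elim i j) hij⟩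
    | k + 2 =>
      have h01 : (0 : Fin (k + 2)) ≠ 1 := by simp
      refine hG.exists_signs_of_ehlich_wojtas_le_det hbpos
        ((hoff 0 1 h01).trans_lt (hG.abs_apply_lt hdiag h01)) k hdiag hoff ?_
      rw [hdet]
      apply le_of_eq
      push_cast
      congr 2
      ring
  refine ⟨1, d, hd, ?_⟩
  have hsq : ∀ i, d i * d i = 1 := fun i => by rcases hd i with h | h <;> simp [h]
  ext i j
  rw [Equiv.Perm.permMatrix, Equiv.Perm.one_def, Equiv.toPEquiv_refl, PEquiv.toMatrix_refl, mul_one,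
    diagonal_transpose, mul_diagonal, diagonal_mul]
  obtain rfl | hij := eq_or_ne i j
  · simp [hdiag, mul_right_comm, hsq]
  · simp only [hGd i j hij, Matrix.add_apply, Matrix.smul_apply, one_apply_ne hij,
      of_apply, smul_eq_mul]
    linear_combination d j * d j * b * hsq i + b * hsq j
end

section
/- Let n be odd and let M be an n × n {±1} matrix. Then |det(M)| ≤ √(2n−1) · (n−1)^((n−1)/2). -/
open Matrix

/-- A weak form of Hadamard's inequality, obtained from the AM-GM inequality for eigenvalues. -/
theorem Matrix.PosSemidef.det_le_pow_card_of_trace_le {ι : Type*} [Fintype ι] [DecidableEq ι]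
    {S : Matrix ι ι ℝ} (hS : S.PosSemidef) {c : ℝ} (hc : 0 < c)
    (htr : S.trace ≤ Fintype.card ι * c) : S.det ≤ c ^ Fintype.card ι := by
  have hdet : S.det = ∏ i, hS.1.eigenvalues i := hS.1.det_eq_prod_eigenvalues
  have htrace : S.trace = ∑ i, hS.1.eigenvalues i := hS.1.trace_eq_sum_eigenvalues
  have hterm (i : ι) : hS.1.eigenvalues i ≤ c * Real.exp (hS.1.eigenvalues i / c - 1) := by
    have h := Real.add_one_le_exp (hS.1.eigenvalues i / c - 1)
    rw [sub_add_cancel, div_le_iff₀ hc] at h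
    linarith
  have hsum : ∑ i, (hS.1.eigenvalues i / c - 1) ≤ 0 := by
    rw [Finset.sum_sub_distrib, ← Finset.sum_div, ← htrace]
    simpa [div_le_iff₀ hc] using htr
  calc S.det = ∏ i, hS.1.eigenvalues i := hdet
    _ ≤ ∏ i, c * Real.exp (hS.1.eigenvalues i / c - 1) :=
      Finset.prod_le_prod (fun i _ => hS.eigenvalues_nonneg i) fun i _ => hterm i
    _ = c ^ Fintype.card ι * Real.exp (∑ i, (hS.1.eigenvalues i / c - 1)) := by
      rw [Finset.prod_mul_distrib, Real.exp_sum]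
      simp
    _ ≤ c ^ Fintype.card ι :=
      mul_le_of_le_one_right (by positivity) (Real.exp_le_one_iff.2 hsum)

/-- Bordering a positive definite matrix `A` with diagonal entries `c + 1` by a column with entries
of absolute value at least one and corner entry one gives a determinant at most `c ^ k`. -/
theorem Matrix.PosDef.det_mul_one_sub_schur_le {ι : Type*} [Fintype ι] [DecidableEq ι]
    {A : Matrix ι ι ℝ} (hA : A.PosDef) {c : ℝ} (hc : 0 < c) (hdiag : ∀ i, A i i = c + 1)
    {B : Matrix ι (Fin 1) ℝ} (hB : ∀ i, 1 ≤ B i 0 ^ 2) :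
    A.det * (1 - (Bᴴ * A⁻¹ * B) 0 0) ≤ c ^ Fintype.card ι := by
  rcases le_total (1 - (Bᴴ * A⁻¹ * B) 0 0) 0 with hq | hq
  · exact (mul_nonpos_of_nonneg_of_nonpos hA.det_pos.le hq).trans (by positivity)
  have : Invertible A := hA.isUnit.invertible
  have hschur : (1 - Bᴴ * A⁻¹ * B).PosSemidef := by
    have h : 1 - Bᴴ * A⁻¹ * B = diagonal fun _ : Fin 1 => 1 - (Bᴴ * A⁻¹ * B) 0 0 := by
      ext i j
      fin_cases i
      fin_cases j
      simp
    rw [h]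
    exact PosSemidef.diagonal fun _ => hq
  have : Invertible (1 : Matrix (Fin 1) (Fin 1) ℝ) := invertibleOne
  have hS : (A - B * Bᴴ).PosSemidef := by
    have h := (PosDef.fromBlocks₂₂ A B (D := (1 : Matrix (Fin 1) (Fin 1) ℝ)) .one).1
      ((PosDef.fromBlocks₁₁ B 1 hA).2 hschur)
    simpa using h
  have hdet : A.det * (1 - (Bᴴ * A⁻¹ * B) 0 0) = (A - B * Bᴴ).det := by
    have h := (det_fromBlocks₁₁ A B Bᴴ 1).symm.trans (det_fromBlocks_one₂₂ A B Bᴴ)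
    rwa [det_fin_one, sub_apply, one_apply_eq, invOf_eq_nonsing_inv] at h
  rw [hdet]
  refine hS.det_le_pow_card_of_trace_le hc ?_
  calc (A - B * Bᴴ).trace = ∑ i, (c + 1 - B i 0 ^ 2) := by
        simp [trace, mul_apply, hdiag, sq]
    _ ≤ ∑ _i : ι, c := Finset.sum_le_sum fun i _ => by linarith [hB i]
    _ = Fintype.card ι * c := by simp

theorem Matrix.PosDef.mul_det_le_of_one_le_sq {c : ℝ} (hc : 0 < c) (k : ℕ)
    {A : Matrix (Fin k) (Fin k) ℝ} (hA : A.PosDef) (hdiag : ∀ i, A i i = c + 1)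
    (hoff : ∀ i j, i ≠ j → 1 ≤ A i j ^ 2) : c * A.det ≤ c ^ k * (c + k) := by
  induction k with
  | zero => simp
  | succ k ih =>
    let e : Fin k ⊕ Fin 1 ≃ Fin (k + 1) := finSumFinEquiv
    set P := A.submatrix e e with hP
    have hPpos : P.PosDef := hA.submatrix e.injective
    have hPpos₁₁ : P.toBlocks₁₁.PosDef := hPpos.submatrix Sum.inl_injective
    have : Invertible P.toBlocks₁₁ := hPpos₁₁.isUnit.invertible
    have hdiag₁₁ (i) : P.toBlocks₁₁ i i = c + 1 := hdiag _
    have hih : c * P.toBlocks₁₁.det ≤ c ^ k * (c + k) :=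
      ih hPpos₁₁ hdiag₁₁ fun i j hij => hoff _ _ (e.injective.ne (Sum.inl_injective.ne hij))
    have hborder := hPpos₁₁.det_mul_one_sub_schur_le hc hdiag₁₁ (B := P.toBlocks₁₂)
      fun i => hoff _ _ (e.injective.ne Sum.inl_ne_inr)
    have h₂₁ : P.toBlocks₂₁ = P.toBlocks₁₂ᴴ := by
      ext i j
      exact (hPpos.1.apply _ _).symm
    have hdet : A.det = P.toBlocks₁₁.det *
        (c + 1 - (P.toBlocks₁₂ᴴ * P.toBlocks₁₁⁻¹ * P.toBlocks₁₂) 0 0) := by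
      have hcorner : P.toBlocks₂₂ 0 0 = c + 1 := hdiag _
      rw [← det_submatrix_equiv_self e A, ← hP, ← fromBlocks_toBlocks P, h₂₁, det_fromBlocks₁₁,
        det_fin_one, sub_apply, invOf_eq_nonsing_inv]
      simp [hcorner]
    rw [Fintype.card_fin] at hborder
    rw [hdet, pow_succ]
    push_cast
    nlinarith [mul_le_mul_of_nonneg_left hih hc.le, mul_le_mul_of_nonneg_left hborder hc.le]

theorem one_le_sq_sum_of_odd_card {ι : Type*} [Fintype ι] (hι : Odd (Fintype.card ι))
    {x : ι → ℝ} (hx : ∀ i, x i = 1 ∨ x i = -1) : 1 ≤ (∑ i, x i) ^ 2 := by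
  have hz (i : ι) : ∃ z : ℤ, x i = 1 + 2 * z := by
    rcases hx i with h | h
    · exact ⟨0, by simp [h]⟩
    · exact ⟨-1, by rw [h]; norm_num⟩
  choose z hz using hz
  obtain ⟨m, hm⟩ := hι
  have hsum : ∑ i, x i = ((2 * (m + ∑ i, z i) + 1 : ℤ) : ℝ) := by
    simp_rw [hz, Finset.sum_add_distrib, ← Finset.mul_sum]
    simp [hm]
    ring
  rw [hsum, one_le_sq_iff_one_le_abs]
  exact_mod_cast Int.one_le_abs (by omega)

/-- The Barba bound: if `n` is odd and `M` is an `n × n` `{±1}` matrix, then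
`|det M| ≤ √(2n - 1) * (n - 1)^((n-1)/2)`. -/
theorem barba_bound (n : ℕ) (hn : Odd n)
    (M : Matrix (Fin n) (Fin n) ℝ)
    (hM : ∀ i j, M i j = 1 ∨ M i j = -1) :
    |M.det| ≤ Real.sqrt (2 * (n : ℝ) - 1) * ((n : ℝ) - 1) ^ ((n - 1) / 2) := by
  obtain ⟨m, rfl⟩ := hn
  have hexp : (2 * m + 1 - 1) / 2 = m := by omega
  have hcast : ((2 * m + 1 : ℕ) : ℝ) - 1 = 2 * m := by push_cast; ring
  rw [hexp, hcast]
  rcases Nat.eq_zero_or_pos m with rfl | hm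
  · have h : M.det = M 0 0 := det_fin_one M
    rw [h]
    rcases hM 0 0 with h | h <;> norm_num [h]
  have hc : (0 : ℝ) < 2 * m := by positivity
  by_cases h0 : M.det = 0
  · rw [h0, abs_zero]
    positivity
  have hunit : IsUnit M := (isUnit_iff_isUnit_det M).2 (isUnit_iff_ne_zero.2 h0)
  have hpos : (M * Mᴴ).PosDef :=
    PosDef.mul_conjTranspose_self M (vecMul_injective_of_isUnit hunit)
  have hgram (i j) : (M * Mᴴ) i j = ∑ k, M i k * M j k := by simp [mul_apply]
  have hkey := hpos.mul_det_le_of_one_le_sq hc (2 * m + 1)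
    (fun i => by
      have h (k) : M i k * M i k = 1 := by rcases hM i k with h | h <;> simp [h]
      rw [hgram]
      simp [h])
    (fun i j _ => by
      rw [hgram]
      refine one_le_sq_sum_of_odd_card (by simp) fun k => ?_
      rcases hM i k with h | h <;> rcases hM j k with h' | h' <;> simp [h, h'])
  rw [det_mul, conjTranspose_eq_transpose_of_trivial, det_transpose, pow_succ',
    mul_assoc (2 * (m : ℝ)) (_ ^ _), mul_le_mul_iff_right₀ hc] at hkey
  have hrad : (0 : ℝ) ≤ 2 * ((2 * m + 1 : ℕ) : ℝ) - 1 := by push_cast; linarith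
  refine abs_le_of_sq_le_sq ?_ (by positivity)
  rw [mul_pow, Real.sq_sqrt hrad, ← pow_mul, mul_comm m 2, sq]
  refine hkey.trans_eq ?_
  push_cast
  ring
end

section
/- Let n be odd and let M be an n × n {±1} matrix. Then there exists a diagonal matrix D with diagonal entries in {1, −1} such that every entry of (D·M)·(D·M)ᵀ is congruent to n modulo 4. -/
open Matrix

/-- A finite product of signs is a sign. -/
theorem Finset.prod_eq_one_or_neg_one {ι : Type*} (s : Finset ι) (z : ι → ℤ)
    (hz : ∀ i ∈ s, z i = 1 ∨ z i = -1) : ∏ i ∈ s, z i = 1 ∨ ∏ i ∈ s, z i = -1 := by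
  refine Finset.prod_induction z (fun x => x = 1 ∨ x = -1) ?_ (Or.inl rfl) hz
  rintro a b (rfl | rfl) (rfl | rfl) <;> simp

/-- Modulo `4`, a sum of signs is determined by their product and their number. -/
theorem Finset.sum_modEq_prod_add_card_sub_one {ι : Type*} (s : Finset ι) (z : ι → ℤ)
    (hz : ∀ i ∈ s, z i = 1 ∨ z i = -1) :
    ∑ i ∈ s, z i ≡ ∏ i ∈ s, z i + s.card - 1 [ZMOD 4] := by
  classical
  induction s using Finset.induction_on with
  | empty => simp
  | insert a s ha ih =>
    have hs : ∀ i ∈ s, z i = 1 ∨ z i = -1 := fun i hi => hz i (Finset.mem_insert_of_mem hi)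
    have h := ih hs
    rw [Finset.sum_insert ha, Finset.prod_insert ha, Finset.card_insert_of_notMem ha]
    rcases hz a (Finset.mem_insert_self a s) with h1 | h1 <;>
      rcases Finset.prod_eq_one_or_neg_one s z hs with h2 | h2 <;>
      rw [h2] at h <;> rw [h1, h2] <;> simp only [Int.ModEq] at h ⊢ <;> push_cast <;> omega

/-- For any `{±1}` matrix `M` of odd order `n` there is a diagonal `{±1}` matrix `D`
such that every entry of the Gram matrix of `D * M` is congruent to `n` modulo `4`. -/
theorem gram_entries_mod_four (n : ℕ) (hn : Odd n)
    (M : Matrix (Fin n) (Fin n) ℤ)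
    (hM : ∀ i j, M i j = 1 ∨ M i j = -1) :
    ∃ d : Fin n → ℤ, (∀ i, d i = 1 ∨ d i = -1) ∧
      ∀ i j, ((Matrix.diagonal d * M) * (Matrix.diagonal d * M)ᵀ) i j ≡ (n : ℤ) [ZMOD 4] := by
  have hd : ∀ i, ∏ k, M i k = 1 ∨ ∏ k, M i k = -1 := fun i =>
    Finset.prod_eq_one_or_neg_one _ _ fun k _ => hM i k
  refine ⟨fun i => ∏ k, M i k, hd, fun i j => ?_⟩
  have hrow : ∀ i, ∏ k, ((∏ l, M i l) * M i k) = 1 := by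
    intro i
    rw [Finset.prod_mul_distrib, Finset.prod_const, Finset.card_univ, Fintype.card_fin]
    rcases hd i with h | h <;> simp [h, hn.neg_one_pow]
  have hsign : ∀ k ∈ Finset.univ,
      (∏ l, M i l) * M i k * ((∏ l, M j l) * M j k) = 1 ∨
        (∏ l, M i l) * M i k * ((∏ l, M j l) * M j k) = -1 := by
    intro k _
    rcases hd i with h1 | h1 <;> rcases hd j with h2 | h2 <;>
      rcases hM i k with h3 | h3 <;> rcases hM j k with h4 | h4 <;> simp [h1, h2, h3, h4]
  have h := Finset.sum_modEq_prod_add_card_sub_one Finset.univ _ hsign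
  rw [Finset.prod_mul_distrib, hrow, hrow, Finset.card_univ, Fintype.card_fin] at h
  rw [Matrix.mul_apply]
  simp only [Matrix.transpose_apply, Matrix.diagonal_mul]
  simpa using h
end

section
/- Let M be an n × n {±1} matrix with |det(M)| = √(2n−1) · (n−1)^((n−1)/2) (i.e., M attains the Barba bound). Then: (1) 2n−1 is a perfect square; (2) n ≡ 1 (mod 4); and (3) there exist a permutation matrix P and a diagonal {±1} matrix D such that, setting N = D·P·M, one has N·Nᵀ = (n−1)·I + J, where I is the identity and J the all-ones matrix of order n. -/
open Matrix

/-- The product of nonnegative reals whose sum is at most their number is at most `1`. -/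
lemma prod_le_one_of_sum_le_card {ι : Type*} [Fintype ι] (x : ι → ℝ) (hx : ∀ i, 0 ≤ x i)
    (hs : ∑ i, x i ≤ Fintype.card ι) : ∏ i, x i ≤ 1 := by
  calc ∏ i, x i ≤ ∏ i, Real.exp (x i - 1) :=
        Finset.prod_le_prod (fun i _ => hx i) fun i _ => by
          linarith [Real.add_one_le_exp (x i - 1)]
    _ = Real.exp (∑ i, (x i - 1)) := (Real.exp_sum _ _).symm
    _ ≤ 1 := by
        rw [Real.exp_le_one_iff]
        simpa using hs

lemma eq_one_of_prod_eq_one_of_sum_le_card {ι : Type*} [Fintype ι] (x : ι → ℝ)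
    (hx : ∀ i, 0 ≤ x i) (hs : ∑ i, x i ≤ Fintype.card ι) (hp : ∏ i, x i = 1) (i : ι) :
    x i = 1 := by
  by_contra hi
  have hpos : ∀ j, 0 < x j := fun j => (hx j).lt_of_ne' fun h => by
    rw [Finset.prod_eq_zero (Finset.mem_univ j) h] at hp
    exact zero_ne_one hp
  have hlt : ∏ j, x j < ∏ j, Real.exp (x j - 1) :=
    Finset.prod_lt_prod (fun j _ => hpos j)
      (fun j _ => by linarith [Real.add_one_le_exp (x j - 1)])
      ⟨i, Finset.mem_univ i, by
        linarith [Real.add_one_lt_exp (sub_ne_zero.mpr hi)]⟩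
  rw [hp, ← Real.exp_sum, Real.one_lt_exp_iff] at hlt
  have : ∑ j, (x j - 1) ≤ 0 := by simpa using hs
  linarith

namespace Matrix

section Hadamard

variable {ι : Type*} [Fintype ι] [DecidableEq ι] {B : Matrix ι ι ℝ} {a : ℝ}

lemma IsHermitian.sum_eigenvalues_div_le (hB : B.IsHermitian) (ha : 0 < a)
    (hd : ∀ i, B i i ≤ a) : ∑ i, hB.eigenvalues i / a ≤ Fintype.card ι := by
  have h : ∑ i, hB.eigenvalues i = B.trace := by simpa using hB.trace_eq_sum_eigenvalues.symm
  rw [← Finset.sum_div, div_le_iff₀ ha, h]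
  calc B.trace ≤ ∑ _i : ι, a := Finset.sum_le_sum fun i _ => hd i
    _ = Fintype.card ι * a := by simp

lemma IsHermitian.prod_eigenvalues_div (hB : B.IsHermitian) :
    ∏ i, hB.eigenvalues i / a = B.det / a ^ Fintype.card ι := by
  rw [Finset.prod_div_distrib, hB.det_eq_prod_eigenvalues]
  simp

/-- Hadamard's inequality for a positive semidefinite matrix with diagonal bounded by `a`. -/
lemma PosSemidef.det_le_pow_of_diag_le (hB : B.PosSemidef) (ha : 0 < a)
    (hd : ∀ i, B i i ≤ a) : B.det ≤ a ^ Fintype.card ι := by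
  have h := prod_le_one_of_sum_le_card _
    (fun i => div_nonneg (hB.eigenvalues_nonneg i) ha.le) (hB.1.sum_eigenvalues_div_le ha hd)
  rwa [hB.1.prod_eigenvalues_div, div_le_one (by positivity)] at h

/-- The equality case of `Matrix.PosSemidef.det_le_pow_of_diag_le`. -/
lemma PosSemidef.eq_smul_one_of_det_eq_pow (hB : B.PosSemidef) (ha : 0 < a)
    (hd : ∀ i, B i i ≤ a) (h : B.det = a ^ Fintype.card ι) : B = a • 1 := by
  have h1 := eq_one_of_prod_eq_one_of_sum_le_card _
    (fun i => div_nonneg (hB.eigenvalues_nonneg i) ha.le) (hB.1.sum_eigenvalues_div_le ha hd)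
    (by rw [hB.1.prod_eigenvalues_div, h, div_self (by positivity)])
  have h2 : hB.1.eigenvalues = fun _ => a := funext fun i => (div_eq_one_iff_eq ha.ne').mp (h1 i)
  have h3 : diagonal (RCLike.ofReal ∘ hB.1.eigenvalues : ι → ℝ) = a • 1 := by
    rw [h2, smul_one_eq_diagonal]
    rfl
  rw [hB.1.spectral_theorem, h3, map_smul, map_one]

end Hadamard

section Bordered

lemma replicateRow_mul_mul_replicateCol_apply {ι : Type*} [Fintype ι] (B : Matrix ι ι ℝ)
    (c d : ι → ℝ) (i j : Fin 1) :
    (replicateRow (Fin 1) c * B * replicateCol (Fin 1) d) i j = c ⬝ᵥ B *ᵥ d := by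
  rw [Matrix.mul_assoc, ← replicateCol_mulVec, replicateRow_mul_replicateCol_apply]

variable {ι : Type*} [Fintype ι] [DecidableEq ι] {A : Matrix ι ι ℝ} {a : ℝ}

lemma det_fromBlocks_replicateCol_fin_one (hA : IsUnit A.det) (c : ι → ℝ) (t : ℝ) :
    (fromBlocks A (replicateCol (Fin 1) c) (replicateRow (Fin 1) c) (of fun _ _ => t)).det
      = A.det * (t - c ⬝ᵥ A⁻¹ *ᵥ c) := by
  let := A.invertibleOfIsUnitDet hA
  rw [det_fromBlocks₁₁, det_fin_one, invOf_eq_nonsing_inv, sub_apply,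
    replicateRow_mul_mul_replicateCol_apply, of_apply]

lemma det_sub_vecMulVec (hA : IsUnit A.det) (c : ι → ℝ) :
    (A - vecMulVec c c).det = A.det * (1 - c ⬝ᵥ A⁻¹ *ᵥ c) := by
  have h := det_add_mul (replicateCol (Fin 1) (-c)) (replicateRow (Fin 1) c) hA
  rw [det_fin_one, Matrix.add_apply, replicateRow_mul_mul_replicateCol_apply, mulVec_neg,
    dotProduct_neg, one_apply_eq, ← sub_eq_add_neg] at h
  rw [sub_eq_add_neg A, ← neg_vecMulVec, vecMulVec_eq (Fin 1)]
  exact h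

lemma PosDef.posSemidef_sub_vecMulVec (hA : A.PosDef) (c : ι → ℝ)
    (hc : 0 < (A - vecMulVec c c).det) : (A - vecMulVec c c).PosSemidef := by
  have hu : IsUnit A.det := hA.det_pos.ne'.isUnit
  let := A.invertibleOfIsUnitDet hu
  rw [det_sub_vecMulVec hu] at hc
  have hq := (mul_pos_iff_of_pos_left hA.det_pos).mp hc
  have h1 := (hA.fromBlocks₁₁ (replicateCol (Fin 1) c) 1).mpr (by
    have : (1 : Matrix (Fin 1) (Fin 1) ℝ)
        - (replicateCol (Fin 1) c)ᴴ * A⁻¹ * replicateCol (Fin 1) c = diagonal fun _ => 1 - c ⬝ᵥ A⁻¹ *ᵥ c := by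
      ext i j
      rw [Subsingleton.elim i j]
      rw [conjTranspose_replicateCol, star_trivial, sub_apply,
        replicateRow_mul_mul_replicateCol_apply, one_apply_eq, diagonal_apply_eq]
    rw [this]
    exact PosSemidef.diagonal fun _ => hq.le)
  let : Invertible (1 : Matrix (Fin 1) (Fin 1) ℝ) := invertibleOne
  have h2 := (PosDef.one.fromBlocks₂₂ A (replicateCol (Fin 1) c)).mp h1
  rw [inv_one, Matrix.mul_one, conjTranspose_replicateCol, star_trivial] at h2
  rw [vecMulVec_eq (Fin 1)]
  exact h2

lemma PosDef.det_sub_vecMulVec_le (hA : A.PosDef) (ha : 0 < a) (hd : ∀ i, A i i = a + 1)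
    (c : ι → ℝ) (hc : ∀ i, 1 ≤ |c i|) : (A - vecMulVec c c).det ≤ a ^ Fintype.card ι := by
  rcases le_or_gt (A - vecMulVec c c).det 0 with h | h
  · exact h.trans (by positivity)
  · refine (hA.posSemidef_sub_vecMulVec c h).det_le_pow_of_diag_le ha fun i => ?_
    have := one_le_sq_iff_one_le_abs (c i) |>.mpr (hc i)
    simp only [sub_apply, vecMulVec_apply, hd]
    nlinarith

lemma PosDef.sub_vecMulVec_eq_of_det_eq (hA : A.PosDef) (ha : 0 < a) (hd : ∀ i, A i i = a + 1)
    (c : ι → ℝ) (hc : ∀ i, 1 ≤ |c i|) (h : (A - vecMulVec c c).det = a ^ Fintype.card ι) :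
    A - vecMulVec c c = a • 1 := by
  refine (hA.posSemidef_sub_vecMulVec c (h ▸ by positivity)).eq_smul_one_of_det_eq_pow ha
    (fun i => ?_) h
  have := one_le_sq_iff_one_le_abs (c i) |>.mpr (hc i)
  simp only [sub_apply, vecMulVec_apply, hd]
  nlinarith

end Bordered

lemma PosDef.det_eq_last_border {a : ℝ} {r : ℕ} {C : Matrix (Fin (r + 1)) (Fin (r + 1)) ℝ}
    (hC : C.PosDef) (hd : C (Fin.last r) (Fin.last r) = a + 1) :
    C.det = a * (C.submatrix Fin.castSucc Fin.castSucc).det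
      + (C.submatrix Fin.castSucc Fin.castSucc
          - vecMulVec (fun i : Fin r => C i.castSucc (Fin.last r))
            fun i : Fin r => C i.castSucc (Fin.last r)).det := by
  have hA := hC.submatrix (Fin.castSucc_injective r)
  have hu : IsUnit (C.submatrix Fin.castSucc Fin.castSucc).det := hA.det_pos.ne'.isUnit
  rw [det_sub_vecMulVec hu, ← det_submatrix_equiv_self finSumFinEquiv C]
  have hb : C.submatrix (finSumFinEquiv (m := r) (n := 1)) (finSumFinEquiv (m := r) (n := 1)) =
      fromBlocks (C.submatrix Fin.castSucc Fin.castSucc)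
        (replicateCol (Fin 1) fun i => C i.castSucc (Fin.last r))
        (replicateRow (Fin 1) fun i => C i.castSucc (Fin.last r)) (of fun _ _ => a + 1) := by
    ext (i | i) (j | j)
    · rfl
    · rw [Subsingleton.elim j 0]; rfl
    · rw [Subsingleton.elim i 0]
      exact (hC.1.apply _ _).symm
    · rw [Subsingleton.elim j 0, Subsingleton.elim i 0]
      exact hd
  rw [hb, det_fromBlocks_replicateCol_fin_one hu]
  ring

/-- Barba's bound for positive definite matrices with constant diagonal `a + 1` and off-diagonal
entries of absolute value at least `1`. -/
lemma PosDef.mul_det_le_of_one_le_abs {a : ℝ} (ha : 0 < a) {r : ℕ} {C : Matrix (Fin r) (Fin r) ℝ}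
    (hC : C.PosDef) (hd : ∀ i, C i i = a + 1) (ho : ∀ i j, i ≠ j → 1 ≤ |C i j|) :
    a * C.det ≤ a ^ r * (a + r) := by
  induction r with
  | zero => simp
  | succ r ih =>
    have hA := hC.submatrix (Fin.castSucc_injective r)
    have h1 := ih hA (fun i => hd _)
      fun i j hij => ho _ _ ((Fin.castSucc_injective r).ne hij)
    have h2 := hA.det_sub_vecMulVec_le ha (fun i => hd _)
      (fun i => C i.castSucc (Fin.last r)) fun i => ho _ _ (Fin.castSucc_lt_last i).ne
    rw [Fintype.card_fin] at h2
    rw [hC.det_eq_last_border (hd _), mul_add]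
    push_cast
    have h3 := mul_le_mul_of_nonneg_left h1 ha.le
    have h4 := mul_le_mul_of_nonneg_left h2 ha.le
    linarith [show a ^ (r + 1) * (a + (r + 1)) = a * (a ^ r * (a + r)) + a * a ^ r by ring]

/-- The equality case of `Matrix.PosDef.mul_det_le_of_one_le_abs`. -/
lemma PosDef.exists_sign_of_mul_det_eq {a : ℝ} (ha : 0 < a) {r : ℕ}
    {C : Matrix (Fin r) (Fin r) ℝ} (hC : C.PosDef) (hd : ∀ i, C i i = a + 1)
    (ho : ∀ i j, i ≠ j → 1 ≤ |C i j|) (h : a * C.det = a ^ r * (a + r)) :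
    ∃ d : Fin r → ℝ, (∀ i, d i = 1 ∨ d i = -1) ∧ C = a • 1 + vecMulVec d d := by
  cases r with
  | zero => exact ⟨fun _ => 1, fun _ => Or.inl rfl, Subsingleton.elim _ _⟩
  | succ r =>
    have hA := hC.submatrix (Fin.castSucc_injective r)
    have h1 := hA.mul_det_le_of_one_le_abs ha (fun i => hd _)
      fun i j hij => ho _ _ ((Fin.castSucc_injective r).ne hij)
    have hc : ∀ i : Fin r, 1 ≤ |C i.castSucc (Fin.last r)| :=
      fun i => ho _ _ (Fin.castSucc_lt_last i).ne
    have h2 := hA.det_sub_vecMulVec_le ha (fun i => hd _) _ hc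
    have hE := hA.sub_vecMulVec_eq_of_det_eq ha (fun i => hd _) _ hc (by
      refine le_antisymm h2 ?_
      rw [Fintype.card_fin]
      rw [hC.det_eq_last_border (hd _), mul_add] at h
      push_cast at h
      refine le_of_mul_le_mul_left ?_ ha
      have h3 := mul_le_mul_of_nonneg_left h1 ha.le
      linarith [show a ^ (r + 1) * (a + (r + 1)) = a * (a ^ r * (a + r)) + a * a ^ r by ring])
    have hsq : ∀ i : Fin r, C i.castSucc (Fin.last r) * C i.castSucc (Fin.last r) = 1 := fun i => by
      have := congrFun (congrFun hE i) i
      simp [vecMulVec_apply, hd] at this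
      linarith
    refine ⟨Fin.lastCases 1 fun i => C i.castSucc (Fin.last r), fun i => ?_, ?_⟩
    · induction i using Fin.lastCases with
      | last => simp
      | cast i => simpa using mul_self_eq_one_iff.mp (hsq i)
    · ext i j
      induction i using Fin.lastCases with
      | last =>
        induction j using Fin.lastCases with
        | last => simp [vecMulVec_apply, hd]
        | cast j =>
          rw [← hC.1.apply]
          simp [vecMulVec_apply, one_apply_ne (Fin.castSucc_lt_last j).ne']
      | cast i =>
        induction j using Fin.lastCases with
        | last => simp [vecMulVec_apply, one_apply_ne (Fin.castSucc_lt_last i).ne]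
        | cast j =>
          have := congrFun (congrFun hE i) j
          simp only [sub_apply, submatrix_apply, sub_eq_iff_eq_add] at this
          simp [this, vecMulVec_apply, one_apply]

end Matrix

/-- The sum of an even number of signs is even, and of an odd number of signs is odd. -/
lemma exists_sum_signs_eq {ι : Type*} (s : Finset ι) (f : ι → ℝ)
    (hf : ∀ i, f i = 1 ∨ f i = -1) : ∃ k : ℤ, ∑ i ∈ s, f i = s.card + 2 * k := by
  have : ∀ i, ∃ k : ℤ, f i = 1 + 2 * k := fun i => by
    rcases hf i with h | h
    · exact ⟨0, by simp [h]⟩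
    · exact ⟨-1, by rw [h]; norm_num⟩
  choose k hk using this
  exact ⟨∑ i ∈ s, k i, by simp [hk, Finset.sum_add_distrib, Finset.mul_sum]⟩

/-- The determinant of a sign matrix is an integer, even as soon as the order is at least two. -/
lemma exists_int_det_eq_of_signs {n : ℕ} (M : Matrix (Fin n) (Fin n) ℝ)
    (hM : ∀ i j, M i j = 1 ∨ M i j = -1) :
    ∃ D : ℤ, M.det = D ∧ (2 ≤ n → Even D) := by
  have : ∀ i j, ∃ z : ℤ, M i j = z ∧ (z : ZMod 2) = 1 := fun i j => by
    rcases hM i j with h | h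
    · exact ⟨1, by simp [h]⟩
    · exact ⟨-1, by simp [h], by decide⟩
  choose Z hZ hZ2 using this
  have hMZ : M = (Int.castRingHom ℝ).mapMatrix (of Z) := by
    ext i j
    simp [hZ]
  refine ⟨(of Z).det, ?_, fun hn => ?_⟩
  · rw [hMZ, ← RingHom.map_det]
    simp
  · rw [← ZMod.intCast_eq_zero_iff_even, ← eq_intCast (Int.castRingHom (ZMod 2)), RingHom.map_det]
    refine det_zero_of_row_eq (i := ⟨0, by omega⟩) (j := ⟨1, by omega⟩) (by simp) ?_
    ext j
    simp [hZ2]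

/-- If `(2n-1)(n-1)^(n-1)` is the square of an integer which is even for `n ≥ 2`, then `2n-1` is
a perfect square and `n ≡ 1 (mod 4)`. -/
lemma exists_sq_and_mod_four_of_sq_eq {n : ℕ} (hn : 1 ≤ n) {D : ℤ}
    (hD : D ^ 2 = (2 * n - 1) * (n - 1) ^ (n - 1)) (hD2 : 2 ≤ n → Even D) :
    (∃ k : ℕ, 2 * n - 1 = k ^ 2) ∧ n % 4 = 1 := by
  rcases hn.eq_or_lt with rfl | hn
  · exact ⟨⟨1, rfl⟩, rfl⟩
  have hodd : n % 2 = 1 := by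
    by_contra h
    have h1 : Even (D ^ 2) := (hD2 hn).pow_of_ne_zero two_ne_zero
    rw [hD] at h1
    have h2 : Odd ((2 * n - 1) * (n - 1) ^ (n - 1) : ℤ) :=
      Odd.mul (by rw [Int.odd_iff]; omega) (Odd.pow (by rw [Int.odd_iff]; omega))
    exact Int.not_even_iff_odd.mpr h2 h1
  obtain ⟨m, rfl⟩ : ∃ m, n = 2 * m + 1 := ⟨n / 2, by omega⟩
  have hm : (0 : ℤ) < (2 * m : ℤ) ^ m := pow_pos (by omega) _
  have hD' : D ^ 2 = (4 * m + 1) * ((2 * m : ℤ) ^ m) ^ 2 := by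
    rw [hD, Nat.add_sub_cancel, ← pow_mul, mul_comm m 2]
    push_cast
    ring
  obtain ⟨k, rfl⟩ : (2 * m : ℤ) ^ m ∣ D :=
    (Int.pow_dvd_pow_iff two_ne_zero).mp ⟨4 * m + 1, by rw [hD', mul_comm]⟩
  have hk : k ^ 2 = 4 * m + 1 := by
    refine mul_right_cancel₀ (pow_pos hm 2).ne' ?_
    rw [← hD']
    ring
  have hk' : ((k.natAbs ^ 2 : ℕ) : ℤ) = 4 * m + 1 := by simp [hk]
  refine ⟨⟨k.natAbs, by omega⟩, ?_⟩
  have hk2 : k % 2 = 1 := by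
    rcases Int.emod_two_eq_zero_or_one k with h | h
    · have : k ^ 2 % 2 = 0 := by simp [pow_two, Int.mul_emod, h]
      omega
    · exact h
  have h8 := Int.eight_dvd_sq_sub_one_of_odd (Int.odd_iff.mpr hk2)
  omega

lemma rpow_half_sub_one_sq {n : ℕ} (hn : 1 ≤ n) :
    (((n : ℝ) - 1) ^ (((n : ℝ) - 1) / 2)) ^ 2 = ((n : ℝ) - 1) ^ (n - 1) := by
  have h0 : (0 : ℝ) ≤ (n : ℝ) - 1 := by
    rw [sub_nonneg]
    exact_mod_cast hn
  rw [← Real.rpow_natCast, ← Real.rpow_mul h0, ← Real.rpow_natCast, Nat.cast_sub hn]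
  congr 1
  push_cast
  ring

/-- If an `n × n` `{±1}` matrix attains the Barba bound
`|det M| = √(2n-1) * (n-1)^((n-1)/2)`, then `2n - 1` is a perfect square,
`n ≡ 1 (mod 4)`, and up to permutation and negation of rows,
the Gram matrix is `(n-1) • I + J`. -/
theorem barba_equality_case (n : ℕ)
    (M : Matrix (Fin n) (Fin n) ℝ)
    (hM : ∀ i j, M i j = 1 ∨ M i j = -1)
    (hdet : |M.det| = Real.sqrt (2 * (n : ℝ) - 1) * ((n : ℝ) - 1) ^ (((n : ℝ) - 1) / 2)) :
    (∃ k : ℕ, 2 * n - 1 = k ^ 2) ∧ n % 4 = 1 ∧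
    ∃ σ : Equiv.Perm (Fin n), ∃ d : Fin n → ℝ, (∀ i, d i = 1 ∨ d i = -1) ∧
      (Matrix.diagonal d * σ.permMatrix ℝ * M) * (Matrix.diagonal d * σ.permMatrix ℝ * M)ᵀ
        = ((n : ℝ) - 1) • (1 : Matrix (Fin n) (Fin n) ℝ) + Matrix.of (fun _ _ => 1) := by
  have hn : 1 ≤ n := by
    by_contra h
    obtain rfl : n = 0 := by omega
    rw [Real.sqrt_eq_zero_of_nonpos (by norm_num)] at hdet
    simp at hdet
  have hn' : (1 : ℝ) ≤ n := by exact_mod_cast hn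
  have hsq : M.det ^ 2 = (2 * n - 1) * ((n : ℝ) - 1) ^ (n - 1) := by
    rw [← sq_abs, hdet, mul_pow, Real.sq_sqrt (by linarith), rpow_half_sub_one_sq hn]
  obtain ⟨D, hD, hD2⟩ := exists_int_det_eq_of_signs M hM
  obtain ⟨hk, h4⟩ := exists_sq_and_mod_four_of_sq_eq hn
    (by rw [hD] at hsq; exact_mod_cast hsq) hD2
  refine ⟨hk, h4, 1, ?_⟩
  have hgram : ∃ d : Fin n → ℝ, (∀ i, d i = 1 ∨ d i = -1) ∧
      M * Mᵀ = ((n : ℝ) - 1) • 1 + vecMulVec d d := by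
    have hdiag : ∀ i, (M * Mᵀ) i i = (n : ℝ) - 1 + 1 := fun i => by
      have : ∀ j, M i j * M i j = 1 := fun j => mul_self_eq_one_iff.mpr (hM i j)
      simp [Matrix.mul_apply, this]
    rcases hn.eq_or_lt with rfl | hn1
    · refine ⟨fun _ => 1, fun _ => Or.inl rfl, ?_⟩
      ext i j
      rw [Subsingleton.elim j i, hdiag]
      simp [vecMulVec_apply]
    have ha : (0 : ℝ) < (n : ℝ) - 1 := by
      rw [sub_pos]
      exact_mod_cast hn1
    have hdet0 : M.det ≠ 0 := fun h => by
      rw [h] at hsq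
      have : (0 : ℝ) < (2 * n - 1) * ((n : ℝ) - 1) ^ (n - 1) :=
        mul_pos (by linarith) (pow_pos ha _)
      linarith
    have hpd : (M * Mᵀ).PosDef := by
      rw [← conjTranspose_eq_transpose_of_trivial]
      exact PosDef.mul_conjTranspose_self M
        (vecMul_injective_of_isUnit ((isUnit_iff_isUnit_det M).mpr hdet0.isUnit))
    refine hpd.exists_sign_of_mul_det_eq ha hdiag (fun i j _ => ?_) ?_
    · obtain ⟨k, hk⟩ := exists_sum_signs_eq Finset.univ (fun l => M i l * M j l) fun l => by
        rcases hM i l with h | h <;> rcases hM j l with h' | h' <;> simp [h, h']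
      rw [Matrix.mul_apply]
      simp only [transpose_apply]
      rw [hk, Finset.card_univ, Fintype.card_fin]
      have : (1 : ℤ) ≤ |n + 2 * k| := Int.one_le_abs (by omega)
      exact_mod_cast this
    · rw [det_mul, det_transpose, ← pow_two, hsq, ← mul_pow_sub_one (by omega : n ≠ 0)]
      ring
  obtain ⟨d, hd, hG⟩ := hgram
  have hdd : ∀ i, d i * d i = 1 := fun i => mul_self_eq_one_iff.mpr (hd i)
  refine ⟨d, hd, ?_⟩
  rw [show (1 : Equiv.Perm (Fin n)).permMatrix ℝ = 1 from Matrix.permMatrix_one, mul_one,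
    transpose_mul, diagonal_transpose, mul_assoc, ← mul_assoc M, hG]
  ext i j
  rw [diagonal_mul, mul_diagonal]
  rcases eq_or_ne i j with rfl | hij
  · simp only [Matrix.add_apply, Matrix.smul_apply, one_apply_eq, vecMulVec_apply, of_apply,
      smul_eq_mul]
    linear_combination ((n : ℝ) - 1 + d i * d i + 1) * hdd i
  · simp only [Matrix.add_apply, Matrix.smul_apply, one_apply_ne hij, vecMulVec_apply, of_apply,
      smul_eq_mul]
    linear_combination d j * d j * hdd i + hdd j
end

section
/- Let n ≡ 2 (mod 4) and let M be an n × n {±1} matrix. Then |det(M)| ≤ (2n−2)·(n−2)^((n−2)/2). Moreover, if |det(M)| attains this bound, then there exist a permutation matrix P and a diagonal {±1} matrix D such that, setting N = D·P·M, the Gram matrix N·Nᵀ equals the block-diagonal matrix [[(n−2)·I + 2·J, 0], [0, (n−2)·I + 2·J]], where both diagonal blocks have size (n/2) × (n/2). -/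
open Matrix

theorem Matrix.PosDef.det_le_one_of_trace_le {ι : Type*} [Fintype ι] [DecidableEq ι]
    {X : Matrix ι ι ℝ} (hX : X.PosDef) (htr : X.trace ≤ Fintype.card ι) :
    X.det ≤ 1 ∧ (X.det = 1 → X = 1) := by
  have hpos := hX.eigenvalues_pos
  set e := hX.1.eigenvalues with he
  have hdet : X.det = ∏ i, e i := by simpa using hX.1.det_eq_prod_eigenvalues
  have hsum : ∑ i, (e i - 1) ≤ 0 := by
    have := hX.1.trace_eq_sum_eigenvalues
    simp only [RCLike.ofReal_real_eq_id, id_eq] at this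
    simp only [Finset.sum_sub_distrib, Finset.sum_const, Finset.card_univ, nsmul_eq_mul, mul_one]
    linarith
  have hle : ∀ i, e i ≤ Real.exp (e i - 1) := fun i => by
    linarith [Real.add_one_le_exp (e i - 1)]
  have hexp : ∏ i, Real.exp (e i - 1) ≤ 1 := by
    rw [← Real.exp_sum]
    exact Real.exp_le_one_iff.mpr hsum
  refine ⟨hdet ▸ (Finset.prod_le_prod (fun i _ => (hpos i).le) fun i _ => hle i).trans hexp,
    fun h => ?_⟩
  have hone : ∀ i, e i = 1 := by
    by_contra! hne
    obtain ⟨i, hi⟩ := hne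
    have hlt : ∏ i, e i < ∏ i, Real.exp (e i - 1) :=
      Finset.prod_lt_prod (fun i _ => hpos i) (fun i _ => hle i)
        ⟨i, Finset.mem_univ i, by linarith [Real.add_one_lt_exp (sub_ne_zero.mpr hi)]⟩
    linarith
  have hfun : hX.1.eigenvalues = fun _ => 1 := funext hone
  rw [hX.1.spectral_theorem, hfun]
  have : diagonal (RCLike.ofReal ∘ fun _ : ι => (1 : ℝ)) = (1 : Matrix ι ι ℝ) := by
    ext i j; simp [diagonal_apply, one_apply]
  rw [this, map_one]

open scoped MatrixOrder in
theorem Matrix.PosDef.exists_isUnit_eq_transpose_mul_self {ι : Type*} [Fintype ι] [DecidableEq ι]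
    {C : Matrix ι ι ℝ} (hC : C.PosDef) : ∃ B : Matrix ι ι ℝ, IsUnit B ∧ C = Bᵀ * B := by
  obtain ⟨B, hB, h⟩ := CStarAlgebra.isStrictlyPositive_iff_eq_star_mul_self.mp
    (isStrictlyPositive_iff_posDef.mpr hC)
  exact ⟨B, hB, by simpa [star_eq_conjTranspose] using h⟩

/-- If `tr (C⁻¹ G) ≤ tr 1` then `det G ≤ det C`, with equality only for `G = C`. -/
theorem Matrix.PosDef.det_le_det_of_trace_inv_mul_le {ι : Type*} [Fintype ι] [DecidableEq ι]
    {C G : Matrix ι ι ℝ} (hC : C.PosDef) (hG : G.PosDef)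
    (htr : (C⁻¹ * G).trace ≤ Fintype.card ι) :
    G.det ≤ C.det ∧ (G.det = C.det → G = C) := by
  obtain ⟨B, hB, rfl⟩ := hC.exists_isUnit_eq_transpose_mul_self
  have hBdet : IsUnit B.det := (isUnit_iff_isUnit_det B).mp hB
  have hBt : IsUnit Bᵀ.det := by rwa [det_transpose]
  have hX : ((B⁻¹)ᵀ * G * B⁻¹).PosDef := by
    simpa [star_eq_conjTranspose] using
      ((isUnit_nonsing_inv_iff.mpr hB).posDef_star_left_conjugate_iff).mpr hG
  have hGX : G = Bᵀ * ((B⁻¹)ᵀ * G * B⁻¹) * B := by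
    rw [transpose_nonsing_inv]
    simp only [Matrix.mul_assoc]
    rw [nonsing_inv_mul _ hBdet, Matrix.mul_one, ← Matrix.mul_assoc, mul_nonsing_inv _ hBt,
      Matrix.one_mul]
  have hXtr : ((B⁻¹)ᵀ * G * B⁻¹).trace ≤ Fintype.card ι := by
    rwa [trace_mul_comm, ← Matrix.mul_assoc, transpose_nonsing_inv, ← Matrix.mul_inv_rev]
  obtain ⟨hle, heq⟩ := hX.det_le_one_of_trace_le hXtr
  set X := (B⁻¹)ᵀ * G * B⁻¹
  have hpos := hC.det_pos
  have hdet : G.det = (Bᵀ * B).det * X.det := by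
    rw [hGX]; simp only [det_mul]; ring
  refine ⟨hdet ▸ mul_le_of_le_one_right hpos.le hle, fun h => ?_⟩
  have : X.det = 1 := by
    rw [hdet] at h
    exact mul_left_cancel₀ hpos.ne' (by rw [h, mul_one])
  rw [hGX, heq this, Matrix.mul_one]

theorem Matrix.PosDef.det_le_pow_of_trace_le {ι : Type*} [Fintype ι] [DecidableEq ι]
    {X : Matrix ι ι ℝ} (hX : X.PosDef) {c : ℝ} (htr : X.trace ≤ Fintype.card ι * c) :
    X.det ≤ c ^ Fintype.card ι ∧ (X.det = c ^ Fintype.card ι → X = diagonal fun _ => c) := by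
  cases isEmpty_or_nonempty ι
  · exact ⟨by simp, fun _ => Subsingleton.elim _ _⟩
  have hc : 0 < c := by
    have := hX.trace_pos.trans_le htr
    exact (mul_pos_iff_of_pos_left (by exact_mod_cast Fintype.card_pos)).mp this
  have hC : (diagonal fun _ : ι => c).PosDef := PosDef.diagonal fun _ => hc
  have hinv : (diagonal fun _ : ι => c)⁻¹ = c⁻¹ • 1 := by
    refine inv_eq_right_inv ?_
    ext i j
    simp [one_apply, hc.ne']
  have := hC.det_le_det_of_trace_inv_mul_le hX (by
    rw [hinv, smul_mul, Matrix.one_mul, trace_smul, smul_eq_mul, inv_mul_le_iff₀ hc]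
    linarith)
  simpa [det_diagonal] using this

/-- **Fischer's inequality** for the partition of the index set by `P`, with its equality case. -/
theorem Matrix.PosDef.det_le_det_mul_det {ι : Type*} [Fintype ι] [DecidableEq ι]
    {G : Matrix ι ι ℝ} (hG : G.PosDef) (P : ι → Prop) [DecidablePred P] :
    G.det ≤ (G.toSquareBlockProp P).det * (G.toSquareBlockProp fun i => ¬P i).det ∧
    (G.det = (G.toSquareBlockProp P).det * (G.toSquareBlockProp fun i => ¬P i).det →
      ∀ i j, ¬(P i ↔ P j) → G i j = 0) := by
  set C : Matrix ι ι ℝ := of fun i j => if (P i ↔ P j) then G i j else 0 with hCdef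
  set S : Matrix ι ι ℝ := diagonal fun i => if P i then 1 else -1 with hS
  have hSS : S * S = 1 := by
    rw [hS, diagonal_mul_diagonal, ← diagonal_one]
    congr 1; ext i; split_ifs <;> norm_num
  have hSunit : IsUnit S := IsUnit.of_mul_eq_one _ hSS
  have hSt : star S = S := by
    rw [star_eq_conjTranspose, hS, diagonal_conjTranspose]; congr 1
  have hSG : (S * G * S).PosDef := by
    simpa [hSt] using (hSunit.posDef_star_left_conjugate_iff).mpr hG
  have hCG : C = (2⁻¹ : ℝ) • (G + S * G * S) := by
    ext i j
    by_cases hi : P i <;> by_cases hj : P j <;>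
      simp [hCdef, hS, diagonal_mul, mul_diagonal, hi, hj] <;> ring
  have hC : C.PosDef := by
    rw [hCG]; exact (hG.add hSG).smul (by norm_num)
  have hSC : S * C * S = C := by
    ext i j
    by_cases hi : P i <;> by_cases hj : P j <;>
      simp [hCdef, hS, diagonal_mul, mul_diagonal, hi, hj]
  have hSinv : S⁻¹ = S := inv_eq_right_inv hSS
  have hSCinv : S * C⁻¹ * S = C⁻¹ := by
    conv_rhs => rw [← hSC, Matrix.mul_inv_rev, Matrix.mul_inv_rev, hSinv, ← Matrix.mul_assoc]
  have htr : (C⁻¹ * G).trace = Fintype.card ι := by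
    have h1 : (C⁻¹ * (S * G * S)).trace = (C⁻¹ * G).trace := by
      conv_rhs => rw [← hSCinv]
      rw [← Matrix.mul_assoc, ← Matrix.mul_assoc, trace_mul_comm]
      simp only [Matrix.mul_assoc]
    have h2 : (C⁻¹ * C).trace = Fintype.card ι := by
      rw [nonsing_inv_mul _ ((isUnit_iff_isUnit_det C).mp hC.isUnit), trace_one]
    have h3 : C⁻¹ * C = (2⁻¹ : ℝ) • (C⁻¹ * G + C⁻¹ * (S * G * S)) := by
      rw [← Matrix.mul_add, ← Matrix.mul_smul, ← hCG]
    rw [h3, trace_smul, trace_add, h1, smul_eq_mul] at h2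
    linarith
  have hdet : C.det =
      (G.toSquareBlockProp P).det * (G.toSquareBlockProp fun i => ¬P i).det := by
    rw [twoBlockTriangular_det C P fun i hi j hj => by simp [hCdef, hi, hj]]
    congr 2 <;> ext i j <;> simp [hCdef, toSquareBlockProp_def, i.2, j.2]
  obtain ⟨hle, heq⟩ := hC.det_le_det_of_trace_inv_mul_le hG htr.le
  rw [← hdet]
  refine ⟨hle, fun h i j hij => ?_⟩
  rw [heq h]; simp [hCdef, hij]

theorem Matrix.det_fromBlocks_bordered_bound {κ : Type*} [Fintype κ] [DecidableEq κ]
    {A : Matrix κ κ ℝ} {v : κ → ℝ} {a b : ℝ} (hb : 0 < b) (hba : b ≤ a)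
    (hA : A.PosDef) (hdiag : ∀ i, A i i = a) (hv : ∀ i, b ≤ |v i|) :
    (fromBlocks (diagonal fun _ : Unit => a) (replicateRow Unit v) (replicateCol Unit v) A).det
      ≤ (a - b) * A.det + b * (a - b) ^ Fintype.card κ ∧
    (0 < (a - b) ^ Fintype.card κ →
      (fromBlocks (diagonal fun _ : Unit => a) (replicateRow Unit v) (replicateCol Unit v) A).det
        = (a - b) * A.det + b * (a - b) ^ Fintype.card κ →
      (∀ i, |v i| = b) ∧ ∀ i j, i ≠ j → A i j = b⁻¹ * (v i * v j)) := by
  set F : ℝ → Matrix (Unit ⊕ κ) (Unit ⊕ κ) ℝ := fun t =>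
    fromBlocks (diagonal fun _ : Unit => t) (replicateRow Unit v) (replicateCol Unit v) A with hF
  let _ : Invertible A := hA.isUnit.invertible
  set q : ℝ := (replicateRow Unit v * A⁻¹ * replicateCol Unit v) () () with hq
  have hFdet : ∀ t, (F t).det = A.det * (t - q) := fun t => by
    simp only [hF]
    rw [det_fromBlocks₂₂, det_unique (n := Unit), invOf_eq_nonsing_inv]
    simp [hq]
  have hsplit : (F a).det = (a - b) * A.det + (F b).det := by
    rw [hFdet, hFdet]; ring
  set T : Matrix κ κ ℝ := A - b⁻¹ • vecMulVec v v with hT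
  have hbPos : (diagonal fun _ : Unit => b).PosDef := PosDef.diagonal fun _ => hb
  let _ : Invertible (diagonal fun _ : Unit => b) := hbPos.isUnit.invertible
  have hinv : (diagonal fun _ : Unit => b)⁻¹ = diagonal fun _ => b⁻¹ := by
    refine inv_eq_right_inv ?_
    rw [diagonal_mul_diagonal, ← diagonal_one]
    simp [hb.ne']
  have hTeq : A - replicateCol Unit v * (diagonal fun _ : Unit => b)⁻¹ * replicateRow Unit v
      = T := by
    rw [hinv]
    ext i j
    simp [hT, Matrix.mul_apply, vecMulVec_apply]; ring
  have hTdet : (F b).det = b * T.det := by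
    simp only [hF]
    rw [det_fromBlocks₁₁, invOf_eq_nonsing_inv, hTeq]
    simp
  have hTdiag : ∀ i, T i i = a - b⁻¹ * |v i| ^ 2 := fun i => by
    simp [hT, vecMulVec_apply, hdiag, sq]
  have hsq : ∀ i, b ≤ b⁻¹ * |v i| ^ 2 := fun i => by
    rw [le_inv_mul_iff₀ hb]
    nlinarith [hv i]
  have hTtr : T.trace ≤ Fintype.card κ * (a - b) := by
    rw [trace, ← nsmul_eq_mul, ← Finset.card_univ]
    refine Finset.sum_le_card_nsmul _ _ _ fun i _ => ?_
    rw [diag_apply, hTdiag]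
    linarith [hsq i]
  have hTpos : 0 < (F b).det → T.PosDef := fun h => by
    have hbq : 0 < b - q := (mul_pos_iff_of_pos_left hA.det_pos).mp (hFdet b ▸ h)
    have hrow : (replicateRow Unit v)ᴴ = replicateCol Unit v := by
      ext; simp
    have hFb : (F b).PosSemidef := by
      have := (PosDef.fromBlocks₂₂ (diagonal fun _ : Unit => b) (replicateRow Unit v) hA).mpr (by
        have : diagonal (fun _ : Unit => b) -
            replicateRow Unit v * A⁻¹ * (replicateRow Unit v)ᴴ = diagonal fun _ => b - q := by
          ext i j
          simp [hq]
        rw [this]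
        exact PosSemidef.diagonal fun _ => hbq.le)
      rwa [hrow] at this
    have hTs : T.PosSemidef := by
      have := (PosDef.fromBlocks₁₁ (replicateRow Unit v) A hbPos).mp (by rwa [hrow])
      rwa [hrow, hTeq] at this
    refine hTs.posDef_iff_det_ne_zero.mpr fun h0 => ?_
    rw [hTdet, h0, mul_zero] at h
    exact h.false
  refine ⟨?_, fun hpow heq => ?_⟩
  · rw [hsplit]
    rcases le_or_gt (F b).det 0 with h | h
    · have : 0 ≤ b * (a - b) ^ Fintype.card κ :=
        mul_nonneg hb.le (pow_nonneg (sub_nonneg.mpr hba) _)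
      linarith
    · rw [hTdet]
      have := ((hTpos h).det_le_pow_of_trace_le hTtr).1
      gcongr
  · have hFb : (F b).det = b * (a - b) ^ Fintype.card κ := by linarith
    have hTP := hTpos (hFb ▸ mul_pos hb hpow)
    have hTd := (hTP.det_le_pow_of_trace_le hTtr).2
      (mul_left_cancel₀ hb.ne' (hTdet ▸ hFb))
    refine ⟨fun i => ?_, fun i j hij => ?_⟩
    · have h1 : a - b⁻¹ * |v i| ^ 2 = a - b := by
        rw [← hTdiag, hTd, diagonal_apply_eq]
      have h2 : b⁻¹ * |v i| ^ 2 = b := by linarith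
      rw [inv_mul_eq_iff_eq_mul₀ hb.ne'] at h2
      exact (sq_eq_sq₀ (abs_nonneg _) hb.le).mp (by rw [h2, sq])
    · have h1 := congr_fun (congr_fun hTd i) j
      rw [diagonal_apply_ne _ hij] at h1
      simp [hT, vecMulVec_apply] at h1
      linarith

/-- Determinant bound for a positive definite matrix with constant diagonal `a` and off-diagonal
entries of absolute value at least `b`, with its equality case. -/
theorem Matrix.PosDef.det_le_of_le_abs_offDiag {a b : ℝ} (hb : 0 < b) (hba : b ≤ a) (k : ℕ)
    {ι : Type} [Fintype ι] [DecidableEq ι] (hk : Fintype.card ι = k + 1)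
    {A : Matrix ι ι ℝ} (hA : A.PosDef) (hdiag : ∀ i, A i i = a)
    (hoff : ∀ i j, i ≠ j → b ≤ |A i j|) :
    A.det ≤ (a - b) ^ k * (a - b + (k + 1) * b) ∧
    (A.det = (a - b) ^ k * (a - b + (k + 1) * b) →
      ∃ s : ι → ℝ, (∀ i, s i = 1 ∨ s i = -1) ∧ ∀ i j, i ≠ j → A i j = b * (s i * s j)) := by
  induction k generalizing ι with
  | zero =>
    have hsub : Subsingleton ι := Fintype.card_le_one_iff_subsingleton.mp (by omega)
    obtain ⟨i⟩ : Nonempty ι := Fintype.card_pos_iff.mp (by omega)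
    refine ⟨by rw [det_eq_elem_of_subsingleton A i, hdiag]; simp,
      fun _ => ⟨fun _ => 1, fun _ => Or.inl rfl, fun i j hij => (hij (Subsingleton.elim i j)).elim⟩⟩
  | succ k ih =>
    obtain ⟨e⟩ : Nonempty (Unit ⊕ Fin (k + 1) ≃ ι) :=
      Fintype.card_eq.mp (by simp [hk]; ring)
    have hinj : Function.Injective (e ∘ Sum.inr) := e.injective.comp Sum.inr_injective
    set A' : Matrix (Fin (k + 1)) (Fin (k + 1)) ℝ := A.submatrix (e ∘ Sum.inr) (e ∘ Sum.inr)
      with hA'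
    set v : Fin (k + 1) → ℝ := fun j => A (e (Sum.inl ())) (e (Sum.inr j)) with hv
    have hsymm : ∀ i j, A i j = A j i := fun i j => by simpa using (hA.1.apply i j).symm
    have hblock : A.submatrix e e = fromBlocks (diagonal fun _ : Unit => a)
        (replicateRow Unit v) (replicateCol Unit v) A' := by
      ext (i | i) (j | j) <;> simp [hv, hA', hdiag, hsymm (e (Sum.inr _)) (e (Sum.inl _))]
    have hA'pos : A'.PosDef := hA.submatrix hinj
    obtain ⟨ihle, -⟩ := ih (by simp) hA'pos (fun i => hdiag _)
      fun i j hij => hoff _ _ (hinj.ne hij)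
    obtain ⟨hle, heq⟩ := det_fromBlocks_bordered_bound hb hba hA'pos (fun i => hdiag _)
      (v := v) fun i => hoff _ _ (e.injective.ne Sum.inl_ne_inr)
    rw [← hblock, det_submatrix_equiv_self, Fintype.card_fin] at hle heq
    have hba0 := sub_nonneg.mpr hba
    have hmul := mul_le_mul_of_nonneg_left ihle hba0
    have hsum : (a - b) * ((a - b) ^ k * (a - b + (k + 1) * b)) + b * (a - b) ^ (k + 1)
        = (a - b) ^ (k + 1) * (a - b + ((k + 1 : ℕ) + 1) * b) := by
      push_cast; ring
    refine ⟨by linarith, fun h => ?_⟩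
    have hpow : 0 < (a - b) ^ (k + 1) := by
      refine (pow_nonneg hba0 _).lt_of_ne fun h0 => ?_
      rw [← h0, zero_mul] at h
      exact hA.det_pos.ne' h
    obtain ⟨hvb, hentry⟩ := heq hpow (by linarith)
    set s' : Unit ⊕ Fin (k + 1) → ℝ := Sum.elim (fun _ => 1) fun j => b⁻¹ * v j with hs'
    refine ⟨s' ∘ e.symm, fun i => ?_, fun i j hij => ?_⟩
    · obtain ⟨x, rfl⟩ := e.surjective i
      rcases x with x | x
      · simp [hs']
      · rcases (abs_eq hb.le).mp (hvb x) with h | h <;> simp [hs', h, hb.ne']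
    · obtain ⟨x, rfl⟩ := e.surjective i
      obtain ⟨y, rfl⟩ := e.surjective j
      rcases x with x | x <;> rcases y with y | y
      · exact (hij rfl).elim
      · simp [hs', hb.ne', hv]
      · rw [hsymm]; simp [hs', hb.ne', hv]
      · have := hentry x y (fun h => hij (by rw [h]))
        simp only [hA', submatrix_apply, Function.comp_apply] at this
        simp only [Function.comp_apply, Equiv.symm_apply_apply, hs', Sum.elim_inr]
        rw [this]; field_simp

theorem Matrix.permMatrix_diagonal_mul_gram_apply {ι : Type*} [Fintype ι] [DecidableEq ι]
    (M : Matrix ι ι ℝ) (σ : Equiv.Perm ι) (d : ι → ℝ) (i j : ι) :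
    ((diagonal d * σ.permMatrix ℝ * M) * (diagonal d * σ.permMatrix ℝ * M)ᵀ) i j
      = d i * d j * (M * Mᵀ) (σ i) (σ j) := by
  have h : diagonal d * σ.permMatrix ℝ * M = of fun i j => d i * M (σ i) j := by
    ext i j
    rw [Matrix.mul_assoc, diagonal_mul, Equiv.Perm.permMatrix, PEquiv.toMatrix_toPEquiv_mul]
    rfl
  rw [h]
  simp only [Matrix.mul_apply, transpose_apply, of_apply, Finset.mul_sum]
  exact Finset.sum_congr rfl fun _ _ => by ring

/-- The rows of a `{±1}` matrix of order `n ≡ 2 (mod 4)` split into two classes such that rows in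
the same class have inner product `≡ 2 (mod 4)`. -/
theorem Matrix.exists_row_classes_two_le_abs_gram {n : ℕ} (hn : n % 4 = 2)
    {M : Matrix (Fin n) (Fin n) ℝ} (hM : ∀ i j, M i j = 1 ∨ M i j = -1) :
    ∃ P : Fin n → Prop, ∀ i j, (P i ↔ P j) → 2 ≤ |(M * Mᵀ) i j| := by
  have hex : ∀ i j, ∃ z : ℤ, (z = 1 ∨ z = -1) ∧ M i j = z := fun i j => by
    rcases hM i j with h | h
    · exact ⟨1, Or.inl rfl, by simp [h]⟩
    · exact ⟨-1, Or.inr rfl, by simp [h]⟩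
  choose m hm hMm using hex
  refine ⟨fun i => (4 : ℤ) ∣ ∑ j, m i j, fun i k hik => ?_⟩
  have heven : ∀ i, (2 : ℤ) ∣ ∑ j, m i j - n := fun i => by
    have : ∑ j, m i j - n = ∑ j, (m i j - 1) := by simp
    rw [this]
    exact Finset.dvd_sum fun j _ => by rcases hm i j with h | h <;> simp [h]
  have hfour : (4 : ℤ) ∣ ∑ j, m i j * m k j - ∑ j, m i j - ∑ j, m k j + n := by
    have : ∑ j, m i j * m k j - ∑ j, m i j - ∑ j, m k j + n
        = ∑ j, (m i j * m k j - m i j - m k j + 1) := by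
      simp [Finset.sum_add_distrib]
    rw [this]
    refine Finset.dvd_sum fun j _ => ?_
    rcases hm i j with h | h <;> rcases hm k j with h' | h' <;> simp [h, h']
  have hcast : (M * Mᵀ) i k = ((∑ j, m i j * m k j : ℤ) : ℝ) := by
    simp [Matrix.mul_apply, hMm]
  have hi := heven i
  have hk := heven k
  have habs : 2 ≤ |∑ j, m i j * m k j| := by
    generalize ∑ j, m i j * m k j = z at *
    beta_reduce at hik
    rw [le_abs]
    omega
  rw [hcast]
  exact_mod_cast habs

/-- The bound on the determinant of a Gram matrix whose index set splits into two classes such that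
entries within a class have absolute value at least `2`, with its equality case. -/
theorem Matrix.PosDef.det_le_of_two_classes {ι : Type} [Fintype ι] [DecidableEq ι]
    {n : ℕ} (hcard : Fintype.card ι = n) (hn : 2 ≤ n)
    {G : Matrix ι ι ℝ} (hG : G.PosDef)
    (hdiag : ∀ i, G i i = n) (P : ι → Prop) [DecidablePred P]
    (hP : ∀ i j, (P i ↔ P j) → 2 ≤ |G i j|) :
    G.det ≤ ((n : ℝ) - 2) ^ (n - 2) * (2 * n - 2) ^ 2 ∧
    (G.det = ((n : ℝ) - 2) ^ (n - 2) * (2 * n - 2) ^ 2 →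
      2 * Fintype.card {i // P i} = n ∧
      ∃ s : ι → ℝ, (∀ i, s i = 1 ∨ s i = -1) ∧
        ∀ i j, i ≠ j → G i j = if (P i ↔ P j) then 2 * (s i * s j) else 0) := by
  have hn' : (2 : ℝ) ≤ n := by exact_mod_cast hn
  have hne : 0 < ((n : ℝ) - 2) ^ (n - 2) := by
    rcases hn.eq_or_lt with h | h
    · simp [← h]
    · have : (2 : ℝ) < n := by exact_mod_cast h
      exact pow_pos (by linarith) _
  have hbig : ((n : ℝ) - 2) ^ (n - 1) * (n - 2 + n * 2) <
      (n - 2) ^ (n - 2) * (2 * n - 2) ^ 2 := by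
    rw [show n - 1 = n - 2 + 1 by omega, pow_succ, mul_assoc]
    refine mul_lt_mul_of_pos_left ?_ hne
    nlinarith
  have hpq : Fintype.card {i // P i} + Fintype.card {i // ¬P i} = n := by
    rw [← hcard, Fintype.card_subtype_compl]
    have := Fintype.card_subtype_le P
    omega
  obtain ⟨hF, hFeq⟩ := hG.det_le_det_mul_det P
  have hpos₁ : (G.toSquareBlockProp P).PosDef := hG.submatrix Subtype.val_injective
  have hpos₂ : (G.toSquareBlockProp fun i => ¬P i).PosDef := hG.submatrix Subtype.val_injective
  have hb₁ := fun k (hk : Fintype.card {i // P i} = k + 1) =>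
    hpos₁.det_le_of_le_abs_offDiag two_pos hn' k hk (fun i => hdiag _)
      fun i j _ => hP _ _ (by simp [i.2, j.2])
  have hb₂ := fun k (hk : Fintype.card {i // ¬P i} = k + 1) =>
    hpos₂.det_le_of_le_abs_offDiag two_pos hn' k hk (fun i => hdiag _)
      fun i j _ => hP _ _ (by simp [i.2, j.2])
  set A := G.toSquareBlockProp P with hA
  set D := G.toSquareBlockProp fun i => ¬P i with hD
  rcases hp : Fintype.card {i // P i} with _ | p
  · have : IsEmpty {i // P i} := Fintype.card_eq_zero_iff.mp hp
    have h1 := (hb₂ (n - 1) (by omega)).1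
    rw [det_isEmpty (A := A), one_mul] at hF
    have : ((n - 1 : ℕ) : ℝ) + 1 = n := by exact_mod_cast (show n - 1 + 1 = n by omega)
    rw [this] at h1
    have hlt := (hF.trans h1).trans_lt hbig
    exact ⟨hlt.le, fun h => absurd h hlt.ne⟩
  rcases hq : Fintype.card {i // ¬P i} with _ | q
  · have : IsEmpty {i // ¬P i} := Fintype.card_eq_zero_iff.mp hq
    have h1 := (hb₁ (n - 1) (by omega)).1
    rw [det_isEmpty (A := D), mul_one] at hF
    have : ((n - 1 : ℕ) : ℝ) + 1 = n := by exact_mod_cast (show n - 1 + 1 = n by omega)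
    rw [this] at h1
    have hlt := (hF.trans h1).trans_lt hbig
    exact ⟨hlt.le, fun h => absurd h hlt.ne⟩
  obtain ⟨h₁, e₁⟩ := hb₁ p hp
  obtain ⟨h₂, e₂⟩ := hb₂ q hq
  have hn2 : n - 2 = p + q := by omega
  have hsum : (p : ℝ) + q + 2 = n := by exact_mod_cast (show p + q + 2 = n by omega)
  set α := ((n : ℝ) - 2) ^ p * (n - 2 + (p + 1) * 2) with hα
  set β := ((n : ℝ) - 2) ^ q * (n - 2 + (q + 1) * 2) with hβ
  have hαβ : α * β = (n - 2) ^ (n - 2) * ((2 * n - 2) ^ 2 - ((p : ℝ) - q) ^ 2) := by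
    rw [hα, hβ, hn2, pow_add, ← hsum]; ring
  have hmul : A.det * D.det ≤ α * β :=
    mul_le_mul h₁ h₂ hpos₂.det_pos.le (hpos₁.det_pos.le.trans h₁)
  have hle : α * β ≤ (n - 2) ^ (n - 2) * (2 * n - 2) ^ 2 := by
    rw [hαβ]
    exact mul_le_mul_of_nonneg_left (by nlinarith [sq_nonneg ((p : ℝ) - q)]) hne.le
  refine ⟨hF.trans (hmul.trans hle), fun h => ?_⟩
  have hGAD : G.det = A.det * D.det := le_antisymm hF (h ▸ hmul.trans hle)
  have hADαβ : A.det * D.det = α * β := le_antisymm hmul (hGAD ▸ h ▸ hle)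
  have hpq' : p = q := by
    have h1 : (n - 2 : ℝ) ^ (n - 2) * ((2 * n - 2) ^ 2 - ((p : ℝ) - q) ^ 2)
        = (n - 2) ^ (n - 2) * (2 * n - 2) ^ 2 := by rw [← hαβ, ← hADαβ, ← hGAD, h]
    have h2 := mul_left_cancel₀ hne.ne' h1
    have h3 : ((p : ℝ) - q) ^ 2 = 0 := by linarith
    exact_mod_cast sub_eq_zero.mp (pow_eq_zero_iff two_ne_zero |>.mp h3)
  obtain ⟨hAα, hDβ⟩ : A.det = α ∧ D.det = β :=
    (mul_eq_mul_iff_eq_and_eq_of_pos h₁ h₂ hpos₁.det_pos (hpos₂.det_pos.trans_le h₂)).mp hADαβ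
  obtain ⟨s₁, hs₁, hA₁⟩ := e₁ hAα
  obtain ⟨s₂, hs₂, hD₂⟩ := e₂ hDβ
  refine ⟨by omega, fun i => if h : P i then s₁ ⟨i, h⟩ else s₂ ⟨i, h⟩, fun i => ?_,
    fun i j hij => ?_⟩
  · by_cases hi : P i
    · simpa [hi] using hs₁ ⟨i, hi⟩
    · simpa [hi] using hs₂ ⟨i, hi⟩
  · by_cases hi : P i <;> by_cases hj : P j
    · simpa [hi, hj, hA, toSquareBlockProp_def] using hA₁ ⟨i, hi⟩ ⟨j, hj⟩ (by simpa using hij)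
    · simpa [hi, hj] using hFeq hGAD i j (by simp [hi, hj])
    · simpa [hi, hj] using hFeq hGAD i j (by simp [hi, hj])
    · simpa [hi, hj, hD, toSquareBlockProp_def] using hD₂ ⟨i, hi⟩ ⟨j, hj⟩ (by simpa using hij)

/-- Ehlich–Wojtas for `n ≡ 2 (mod 4)`: any `n × n` `{±1}` matrix satisfies
`|det M| ≤ (2n-2)(n-2)^((n-2)/2)`; moreover, if the bound is attained then after
permuting and negating rows the Gram matrix is block diagonal with two
`(n/2) × (n/2)` blocks `(n-2)·I + 2·J` (so the `(i,j)` entry equals `n` when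
`i = j`, equals `2` when `i ≠ j` lie in the same half, and `0` otherwise). -/
theorem ehlich_wojtas_two_mod_four (n : ℕ) (hn : n % 4 = 2)
    (M : Matrix (Fin n) (Fin n) ℝ)
    (hM : ∀ i j, M i j = 1 ∨ M i j = -1) :
    |M.det| ≤ (2 * (n : ℝ) - 2) * ((n : ℝ) - 2) ^ ((n - 2) / 2) ∧
    (|M.det| = (2 * (n : ℝ) - 2) * ((n : ℝ) - 2) ^ ((n - 2) / 2) →
      ∃ σ : Equiv.Perm (Fin n), ∃ d : Fin n → ℝ, (∀ i, d i = 1 ∨ d i = -1) ∧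
        (Matrix.diagonal d * σ.permMatrix ℝ * M) * (Matrix.diagonal d * σ.permMatrix ℝ * M)ᵀ
          = Matrix.of (fun i j : Fin n =>
              if i = j then (n : ℝ)
              else if ((i : ℕ) < n / 2 ↔ (j : ℕ) < n / 2) then 2 else 0)) := by
  have hn2 : 2 ≤ n := by omega
  have hn' : (2 : ℝ) ≤ n := by exact_mod_cast hn2
  have hbound0 : 0 ≤ (2 * (n : ℝ) - 2) * ((n : ℝ) - 2) ^ ((n - 2) / 2) :=
    mul_nonneg (by linarith) (pow_nonneg (by linarith) _)
  have hsq : ((2 * (n : ℝ) - 2) * ((n : ℝ) - 2) ^ ((n - 2) / 2)) ^ 2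
      = ((n : ℝ) - 2) ^ (n - 2) * (2 * n - 2) ^ 2 := by
    rw [mul_pow, ← pow_mul, show (n - 2) / 2 * 2 = n - 2 by omega, mul_comm]
  have hdetG : (M * Mᵀ).det = |M.det| ^ 2 := by
    rw [det_mul, det_transpose, sq_abs, sq]
  by_cases h0 : M.det = 0
  · refine ⟨by simpa [h0] using hbound0, fun h => ?_⟩
    rw [h0, abs_zero] at h
    have hpos : 0 < (2 * (n : ℝ) - 2) * ((n : ℝ) - 2) ^ ((n - 2) / 2) := by
      refine mul_pos (by linarith) ?_
      rcases hn2.eq_or_lt with h | h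
      · simp [← h]
      · have : (2 : ℝ) < n := by exact_mod_cast h
        exact pow_pos (by linarith) _
    exact absurd h hpos.ne
  have hG : (M * Mᵀ).PosDef := by
    have hs : (M * Mᵀ).PosSemidef := by
      simpa using posSemidef_self_mul_conjTranspose M
    exact hs.posDef_iff_det_ne_zero.mpr (by simp [hdetG, h0])
  have hdiag : ∀ i, (M * Mᵀ) i i = n := fun i => by
    have : ∀ j, M i j * M i j = 1 := fun j => by rcases hM i j with h | h <;> simp [h]
    simp [Matrix.mul_apply, this]
  obtain ⟨P, hP⟩ := exists_row_classes_two_le_abs_gram hn hM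
  classical
  obtain ⟨hle, heq⟩ := hG.det_le_of_two_classes (Fintype.card_fin n) hn2 hdiag P hP
  rw [hdetG, ← hsq] at hle heq
  refine ⟨(sq_le_sq₀ (abs_nonneg _) hbound0).mp hle, fun h => ?_⟩
  obtain ⟨hcard, s, hs, hentry⟩ := heq (by rw [h])
  obtain ⟨e⟩ : Nonempty ({i : Fin n // (i : ℕ) < n / 2} ≃ {i // P i}) := by
    refine Fintype.card_eq.mp ?_
    rw [Fintype.card_subtype fun i : Fin n => (i : ℕ) < n / 2, Fin.card_filter_val_lt]
    omega
  have hσ : ∀ i, P (e.extendSubtype i) ↔ (i : ℕ) < n / 2 := fun i =>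
    ⟨fun h => by_contra fun hi => e.extendSubtype_not_mem i hi h, e.extendSubtype_mem i⟩
  refine ⟨e.extendSubtype, fun i => s (e.extendSubtype i), fun i => hs _, ?_⟩
  ext i j
  rw [permMatrix_diagonal_mul_gram_apply, of_apply]
  have hss : ∀ i, s i * s i = 1 := fun i => by rcases hs i with h | h <;> simp [h]
  by_cases hij : i = j
  · rw [if_pos hij, ← hij, hss, hdiag, one_mul]
  · rw [if_neg hij, hentry _ _ (e.extendSubtype.injective.ne hij)]
    simp only [hσ]
    split_ifs
    · linear_combination 2 * s (e.extendSubtype j) * s (e.extendSubtype j)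
        * hss (e.extendSubtype i) + 2 * hss (e.extendSubtype j)
    · simp
end

section
/- Let n ≡ 2 (mod 4) and let M be an n × n {±1} matrix with |det(M)| = (2n−2)·(n−2)^((n−2)/2) (i.e., M attains the Ehlich–Wojtas bound for n ≡ 2 mod 4). Then 2n−2 is a sum of two integer squares: there exist integers a and b with a² + b² = 2n−2. -/
open Matrix

namespace EhlichWojtas

variable {ι : Type*} [Fintype ι] [DecidableEq ι]

/-- Among positive definite matrices of trace at most `card ι`, the identity is the unique
maximiser of the determinant. -/
lemma det_le_one_of_trace_le {P : Matrix ι ι ℝ} (hP : P.PosDef)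
    (htr : P.trace ≤ Fintype.card ι) : P.det ≤ 1 ∧ (P.det = 1 → P = 1) := by
  have hdet : P.det = ∏ i, hP.1.eigenvalues i := by simpa using hP.1.det_eq_prod_eigenvalues
  have htrace : P.trace = ∑ i, hP.1.eigenvalues i := by simpa using hP.1.trace_eq_sum_eigenvalues
  have hle : ∀ i, hP.1.eigenvalues i ≤ Real.exp (hP.1.eigenvalues i - 1) := fun i => by
    linarith [Real.add_one_le_exp (hP.1.eigenvalues i - 1)]
  have hexp : ∏ i, Real.exp (hP.1.eigenvalues i - 1) ≤ 1 := by
    rw [← Real.exp_sum, Real.exp_le_one_iff, Finset.sum_sub_distrib, ← htrace]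
    simpa using htr
  refine ⟨?_, fun h1 => ?_⟩
  · rw [hdet]
    exact (Finset.prod_le_prod (fun i _ => (hP.eigenvalues_pos i).le) fun i _ => hle i).trans hexp
  · have hone : ∀ i, hP.1.eigenvalues i = 1 := by
      by_contra! hne
      obtain ⟨i, hi⟩ := hne
      have hlt : ∏ i, hP.1.eigenvalues i < ∏ i, Real.exp (hP.1.eigenvalues i - 1) :=
        Finset.prod_lt_prod (fun i _ => hP.eigenvalues_pos i) (fun i _ => hle i)
          ⟨i, Finset.mem_univ i, by
            linarith [Real.add_one_lt_exp (sub_ne_zero.mpr hi)]⟩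
      linarith
    have hspec := hP.1.spectral_theorem
    have hd : diagonal (RCLike.ofReal ∘ hP.1.eigenvalues) = (1 : Matrix ι ι ℝ) := by
      rw [← diagonal_one]
      congr 1
      ext i
      simp [hone i]
    rw [hd, map_one] at hspec
    exact hspec

lemma det_le_of_trace_inv_mul_le {X Y : Matrix ι ι ℝ} (hX : X.PosDef) (hY : Y.PosDef)
    (htr : (X⁻¹ * Y).trace ≤ Fintype.card ι) : Y.det ≤ X.det ∧ (Y.det = X.det → Y = X) := by
  obtain ⟨B, hB⟩ : ∃ B : Matrix ι ι ℝ, X = Bᵀ * B := by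
    open scoped MatrixOrder Matrix.Norms.L2Operator in
    obtain ⟨B, hB⟩ := CStarAlgebra.nonneg_iff_eq_star_mul_self.mp hX.posSemidef.nonneg
    exact ⟨B, by rw [hB, star_eq_conjTranspose, conjTranspose_eq_transpose_of_trivial]⟩
  have hBX : X.det = B.det ^ 2 := by rw [hB, det_mul, det_transpose, sq]
  have hB0 : B.det ≠ 0 := by
    intro h
    have := hX.det_pos
    rw [hBX, h] at this
    norm_num at this
  have hBu : IsUnit B.det := isUnit_iff_ne_zero.mpr hB0
  have hBtu : IsUnit Bᵀ.det := by rwa [det_transpose]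
  have hPpos : ((B⁻¹)ᵀ * Y * B⁻¹).PosDef := by
    rw [← conjTranspose_eq_transpose_of_trivial]
    refine hY.conjTranspose_mul_mul_same ?_
    apply mulVec_injective_of_isUnit
    exact (isUnit_iff_isUnit_det _).mpr (isUnit_nonsing_inv_det B hBu)
  have hPtr : ((B⁻¹)ᵀ * Y * B⁻¹).trace ≤ Fintype.card ι := by
    rwa [trace_mul_comm, ← mul_assoc, transpose_nonsing_inv, ← Matrix.mul_inv_rev, ← hB]
  have hPdet : ((B⁻¹)ᵀ * Y * B⁻¹).det = Y.det / X.det := by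
    rw [det_mul, det_mul, det_transpose, det_nonsing_inv, hBX, Ring.inverse_eq_inv']
    field_simp
  obtain ⟨h1, h2⟩ := det_le_one_of_trace_le hPpos hPtr
  rw [hPdet] at h1 h2
  refine ⟨(div_le_one hX.det_pos).mp h1, fun h => ?_⟩
  have h3 := h2 ((div_eq_one_iff_eq hX.det_pos.ne').mpr h)
  have h4 : Bᵀ * ((B⁻¹)ᵀ * Y * B⁻¹) * B = Y := by
    rw [transpose_nonsing_inv]
    rw [mul_assoc, mul_assoc, nonsing_inv_mul _ hBu, mul_one, ← mul_assoc, mul_nonsing_inv _ hBtu,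
      one_mul]
  rw [← h4, h3, mul_one, hB]

lemma det_le_pow_of_diag_le {P : Matrix ι ι ℝ} (hP : P.PosDef) {d : ℝ} (hd : 0 < d)
    (hdiag : ∀ i, P i i ≤ d) :
    P.det ≤ d ^ Fintype.card ι ∧ (P.det = d ^ Fintype.card ι → P = d • 1) := by
  have hX : (d • (1 : Matrix ι ι ℝ)).PosDef := PosDef.one.smul hd
  have hdet : (d • (1 : Matrix ι ι ℝ)).det = d ^ Fintype.card ι := by simp
  rw [← hdet]
  refine det_le_of_trace_inv_mul_le hX hP ?_
  have hinv : (d • (1 : Matrix ι ι ℝ))⁻¹ = d⁻¹ • 1 := by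
    apply inv_eq_right_inv
    simp [smul_smul, hd.ne']
  rw [hinv, smul_mul_assoc, one_mul, trace_smul, smul_eq_mul, inv_mul_le_iff₀ hd]
  calc P.trace ≤ ∑ _i : ι, d := Finset.sum_le_sum fun i _ => hdiag i
    _ = d * Fintype.card ι := by simp [mul_comm]

/-- Fischer's inequality, with its case of equality, for a two-class partition. -/
lemma fischer {G : Matrix ι ι ℝ} (hG : G.PosDef) (κ : ι → Prop) [DecidablePred κ] :
    G.det ≤ (toSquareBlockProp G κ).det * (toSquareBlockProp G fun i => ¬κ i).det ∧
    (G.det = (toSquareBlockProp G κ).det * (toSquareBlockProp G fun i => ¬κ i).det →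
      ∀ i j, ¬(κ i ↔ κ j) → G i j = 0) := by
  set X : Matrix ι ι ℝ := of fun i j => if κ i ↔ κ j then G i j else 0 with hXdef
  set S : Matrix ι ι ℝ := diagonal fun i => if κ i then 1 else -1 with hS
  have hSS : S * S = 1 := by
    rw [hS, diagonal_mul_diagonal, ← diagonal_one]
    congr 1
    ext i
    split_ifs <;> norm_num
  have hSu : IsUnit S := IsUnit.of_mul_eq_one S hSS
  have hSinv : S⁻¹ = S := inv_eq_right_inv hSS
  have hSGS : (S * G * S).PosDef := by
    have hSt : Sᴴ = S := by simp [hS]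
    have := hG.conjTranspose_mul_mul_same (mulVec_injective_of_isUnit hSu)
    rwa [hSt] at this
  have h2X : G + S * G * S = (2 : ℝ) • X := by
    ext i j
    simp only [hS, hXdef, Matrix.add_apply, Matrix.smul_apply, of_apply, mul_diagonal, diagonal_mul, smul_eq_mul]
    by_cases h1 : κ i <;> by_cases h2 : κ j <;> simp [h1, h2] <;> ring
  have hX : X.PosDef := by
    have : X = (2⁻¹ : ℝ) • (G + S * G * S) := by rw [h2X, smul_smul]; norm_num
    rw [this]
    exact (hG.add hSGS).smul (by norm_num)
  have hXinv : S * X⁻¹ * S = X⁻¹ := by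
    have hSXS : S * X * S = X := by
      ext i j
      simp only [hS, hXdef, of_apply, mul_diagonal, diagonal_mul]
      by_cases h1 : κ i <;> by_cases h2 : κ j <;> simp [h1, h2]
    conv_rhs => rw [← hSXS]
    rw [Matrix.mul_inv_rev, Matrix.mul_inv_rev, hSinv, mul_assoc]
  have htr : (X⁻¹ * G).trace ≤ Fintype.card ι := by
    have h1 : (X⁻¹ * (S * G * S)).trace = (X⁻¹ * G).trace := by
      conv_rhs => rw [← hXinv]
      rw [← mul_assoc, ← mul_assoc, trace_mul_comm, ← mul_assoc, ← mul_assoc]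
    have h2 : (X⁻¹ * G).trace + (X⁻¹ * (S * G * S)).trace = 2 * Fintype.card ι := by
      rw [← trace_add, ← mul_add, h2X, mul_smul_comm,
        nonsing_inv_mul _ ((isUnit_iff_isUnit_det _).mp hX.isUnit)]
      simp
    linarith
  have hdet : X.det = (toSquareBlockProp G κ).det * (toSquareBlockProp G fun i => ¬κ i).det := by
    rw [X.twoBlockTriangular_det κ fun i hi j hj => by simp [hXdef, hi, hj]]
    congr 2 <;> ext ⟨i, hi⟩ ⟨j, hj⟩ <;> simp [hXdef, toSquareBlockProp, hi, hj]
  rw [← hdet]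
  obtain ⟨h1, h2⟩ := det_le_of_trace_inv_mul_le hX hG htr
  refine ⟨h1, fun h i j hij => ?_⟩
  rw [h2 h]
  simp [hXdef, hij]

/-- Bordering a matrix by one row and column whose entries are bounded below in absolute value. -/
lemma det_bordered_le {c d : ℝ} (hc : 0 < c) (hd : 0 < d) {A : Matrix (Unit ⊕ ι) (Unit ⊕ ι) ℝ}
    (hA : A.PosDef) (hdiag : ∀ i, A i i = d + c) (hoff : ∀ i j, i ≠ j → c ≤ |A i j|) :
    A.det ≤ d * A.toBlocks₂₂.det + c * d ^ Fintype.card ι ∧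
    (A.det = d * A.toBlocks₂₂.det + c * d ^ Fintype.card ι →
      ∃ s : Unit ⊕ ι → ℝ, (∀ i, s i ^ 2 = 1) ∧ ∀ i j, i ≠ j → A i j = c * (s i * s j)) := by
  set B := A.toBlocks₂₂ with hBdef
  set V := A.toBlocks₁₂ with hVdef
  have hsymm : ∀ i j, A i j = A j i := fun i j => by
    simpa using hA.1.apply j i
  have hB : B.PosDef := hA.submatrix Sum.inr_injective
  have hV : A.toBlocks₂₁ = Vᴴ := by
    ext i j
    simp [hVdef, toBlocks₂₁, toBlocks₁₂, hsymm (Sum.inr i)]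
  have hblocks : ∀ a : ℝ, (fromBlocks (a • (1 : Matrix Unit Unit ℝ)) V Vᴴ B).det =
      B.det * (a - (V * B⁻¹ * Vᴴ) () ()) := fun a => by
    let := hB.isUnit.invertible
    rw [det_fromBlocks₂₂, det_unique (n := Unit), invOf_eq_nonsing_inv]
    simp
  set t := (V * B⁻¹ * Vᴴ) () () with ht
  have hAdet : A.det = B.det * (d + c - t) := by
    rw [← hblocks, ← hV]
    conv_lhs => rw [← fromBlocks_toBlocks A]
    congr 2
    ext i j
    simp [toBlocks₁₁, hdiag]
  have hBpos := hB.det_pos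
  have hpow : 0 < c * d ^ Fintype.card ι := by positivity
  rcases le_or_gt c t with hct | hct
  · have : B.det * (d + c - t) ≤ d * B.det := by nlinarith
    exact ⟨by linarith, fun h => by linarith⟩
  let := hB.isUnit.invertible
  have hcX : (c • (1 : Matrix Unit Unit ℝ)).PosDef := PosDef.one.smul hc
  let := hcX.isUnit.invertible
  have hcinv : (c • (1 : Matrix Unit Unit ℝ))⁻¹ = c⁻¹ • 1 := by
    apply inv_eq_right_inv
    simp [smul_smul, hc.ne']
  have hA' : (fromBlocks (c • (1 : Matrix Unit Unit ℝ)) V Vᴴ B).PosSemidef := by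
    rw [PosDef.fromBlocks₂₂ _ _ hB]
    have : c • (1 : Matrix Unit Unit ℝ) - V * B⁻¹ * Vᴴ = diagonal fun _ => c - t := by
      ext i j
      simp [ht]
    rw [this]
    exact PosSemidef.diagonal fun _ => by simpa using hct.le
  have hP : (B - Vᴴ * (c • (1 : Matrix Unit Unit ℝ))⁻¹ * V).PosSemidef :=
    (PosDef.fromBlocks₁₁ _ _ hcX).mp hA'
  have hdetP : c * (B - Vᴴ * (c • (1 : Matrix Unit Unit ℝ))⁻¹ * V).det = B.det * (c - t) := by
    rw [← hblocks, det_fromBlocks₁₁, invOf_eq_nonsing_inv]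
    simp
  set P := B - Vᴴ * (c • (1 : Matrix Unit Unit ℝ))⁻¹ * V with hPdef
  have hPentry : ∀ i j, P i j = B i j - V () i * V () j / c := fun i j => by
    rw [hPdef, hcinv]
    simp [mul_apply]
    ring
  have hPpos : P.PosDef := by
    rw [hP.posDef_iff_det_ne_zero]
    intro h
    rw [h, mul_zero] at hdetP
    have := mul_pos hBpos (sub_pos.mpr hct)
    linarith
  have hVsq : ∀ i, c ^ 2 ≤ V () i ^ 2 := fun i => by
    rw [← sq_abs (V () i)]
    exact pow_le_pow_left₀ hc.le (hoff (Sum.inl ()) (Sum.inr i) (by simp)) 2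
  have hPdiag : ∀ i, P i i ≤ d := fun i => by
    have h1 : B i i = d + c := hdiag _
    have h2 : c ≤ V () i * V () i / c := by
      rw [le_div_iff₀ hc]
      nlinarith [hVsq i]
    rw [hPentry]
    linarith
  obtain ⟨h1, h2⟩ := det_le_pow_of_diag_le hPpos hd hPdiag
  have hAP : A.det = d * B.det + c * P.det := by rw [hAdet, hdetP]; ring
  refine ⟨by rw [hAP]; gcongr, fun h => ?_⟩
  have hPd : P = d • 1 := h2 (mul_left_cancel₀ hc.ne' (by linarith))
  have hBij : ∀ i j, B i j = (d • (1 : Matrix ι ι ℝ)) i j + V () i * V () j / c := fun i j => by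
    rw [← hPd, hPentry]; ring
  have hVc : ∀ i, V () i ^ 2 = c ^ 2 := fun i => by
    have h3 := hBij i i
    have h4 : B i i = d + c := hdiag _
    rw [h4, Matrix.smul_apply, one_apply_eq, smul_eq_mul, mul_one] at h3
    field_simp at h3
    linarith
  refine ⟨Sum.elim (fun _ => 1) fun i => V () i / c, ?_, ?_⟩
  · rintro (i | i)
    · simp
    · simp [div_pow, hVc i, hc.ne']
  · have hinlr : ∀ i j, A (Sum.inl i) (Sum.inr j) = c * (V () j / c) := fun i j => by
      rw [mul_div_cancel₀ _ hc.ne']; rfl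
    rintro (i | i) (j | j) hij
    · exact absurd rfl hij
    · simpa using hinlr i j
    · rw [hsymm]
      simpa using hinlr j i
    · have hne : i ≠ j := fun h => hij (by rw [h])
      have h5 : A (Sum.inr i) (Sum.inr j) = V () i * V () j / c := by
        have h6 := hBij i j
        rw [Matrix.smul_apply, one_apply_ne hne, smul_zero, zero_add] at h6
        exact h6
      rw [h5]
      simp only [Sum.elim_inr]
      field_simp

/-- The determinant bound for a positive definite matrix with diagonal entries `d + c` and
off-diagonal entries of absolute value at least `c`, together with its case of equality. -/
lemma det_le_of_offDiag_ge {c d : ℝ} (hc : 0 < c) (hd : 0 < d) {A : Matrix ι ι ℝ}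
    (hA : A.PosDef) (hdiag : ∀ i, A i i = d + c) (hoff : ∀ i j, i ≠ j → c ≤ |A i j|) :
    d * A.det ≤ d ^ Fintype.card ι * (d + Fintype.card ι * c) ∧
    (d * A.det = d ^ Fintype.card ι * (d + Fintype.card ι * c) →
      ∃ s : ι → ℝ, (∀ i, s i ^ 2 = 1) ∧ ∀ i j, i ≠ j → A i j = c * (s i * s j)) := by
  induction hk : Fintype.card ι generalizing ι with
  | zero =>
    have := Fintype.card_eq_zero_iff.mp hk
    exact ⟨by simp, fun _ => ⟨fun _ => 1, by simp, fun i => isEmptyElim i⟩⟩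
  | succ k ih =>
    obtain ⟨e⟩ : Nonempty (Unit ⊕ ULift (Fin k) ≃ ι) := ⟨Fintype.equivOfCardEq (by simp [hk, add_comm])⟩
    have hA' : (A.submatrix e e).PosDef := hA.submatrix e.injective
    have hoff' : ∀ i j, i ≠ j → c ≤ |A.submatrix e e i j| := fun i j hij =>
      hoff _ _ fun h => hij (e.injective h)
    obtain ⟨h1, h2⟩ := det_bordered_le hc hd hA' (fun i => hdiag _) hoff'
    obtain ⟨h3, -⟩ := ih (A := (A.submatrix e e).toBlocks₂₂)
      (hA'.submatrix Sum.inr_injective) (fun i => hdiag _)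
      (fun i j hij => hoff' _ _ fun h => hij (Sum.inr_injective h)) (by simp)
    rw [det_submatrix_equiv_self, Fintype.card_ulift, Fintype.card_fin] at h1 h2
    have h4 := mul_le_mul_of_nonneg_left h1 hd.le
    have h5 := mul_le_mul_of_nonneg_left h3 hd.le
    have h6 : d * (d ^ k * (d + k * c)) + d * (c * d ^ k) =
        d ^ (k + 1) * (d + (k + 1 : ℕ) * c) := by
      push_cast; ring
    refine ⟨by linarith, fun h => ?_⟩
    obtain ⟨s, hs, hs'⟩ := h2 (mul_left_cancel₀ hd.ne' (by linarith))
    refine ⟨s ∘ e.symm, fun i => hs _, fun i j hij => ?_⟩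
    simpa using hs' (e.symm i) (e.symm j) (by simpa using hij)

/-- A positive definite matrix attaining the Ehlich–Wojtas bound is, up to signs, a direct sum of
two copies of `d • 1 + c • J`. -/
lemma exists_two_block_of_det_eq {c d : ℝ} (hc : 0 < c) (hd : 0 < d) {G : Matrix ι ι ℝ}
    (hG : G.PosDef) (hdiag : ∀ i, G i i = d + c) (κ : ι → Prop)
    (hoff : ∀ i j, i ≠ j → (κ i ↔ κ j) → c ≤ |G i j|)
    (hdet : d ^ 2 * G.det = d ^ Fintype.card ι * (d + Fintype.card ι / 2 * c) ^ 2) :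
    ∃ u w : ι → ℝ, (∀ i, u i ^ 2 = 1 ∧ w i = 0 ∨ u i = 0 ∧ w i ^ 2 = 1) ∧
      u ⬝ᵥ u = Fintype.card ι / 2 ∧ w ⬝ᵥ w = Fintype.card ι / 2 ∧
      G = d • 1 + c • (vecMulVec u u + vecMulVec w w) := by
  classical
  obtain ⟨hF, hFeq⟩ := fischer hG κ
  have hA : (toSquareBlockProp G κ).PosDef := hG.submatrix Subtype.val_injective
  have hD : (toSquareBlockProp G fun i => ¬κ i).PosDef := hG.submatrix Subtype.val_injective
  obtain ⟨hA1, hA2⟩ := det_le_of_offDiag_ge hc hd hA (fun i => hdiag _) fun i j hij =>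
    hoff _ _ (fun h => hij (Subtype.ext h)) (iff_of_true i.2 j.2)
  obtain ⟨hD1, hD2⟩ := det_le_of_offDiag_ge hc hd hD (fun i => hdiag _) fun i j hij =>
    hoff _ _ (fun h => hij (Subtype.ext h)) (iff_of_false i.2 j.2)
  have hcard : Fintype.card ι = Fintype.card {i // κ i} + Fintype.card {i // ¬κ i} :=
    (Fintype.card_congr (Equiv.sumCompl κ)).symm.trans Fintype.card_sum
  have hAdet := hA.det_pos
  have hDdet := hD.det_pos
  set r := Fintype.card {i // κ i} with hr
  set t := Fintype.card {i // ¬κ i} with ht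
  set a := (toSquareBlockProp G κ).det
  set b := (toSquareBlockProp G fun i => ¬κ i).det
  have hp : 0 < d ^ r * (d + r * c) := by positivity
  have hq : 0 < d ^ t * (d + t * c) := by positivity
  have hN : 0 < d ^ (r + t) := by positivity
  have hbal : d ^ (r + t) * (d + (r + t : ℕ) / 2 * c) ^ 2 =
      (d ^ r * (d + r * c)) * (d ^ t * (d + t * c)) + d ^ (r + t) * (c * (r - t) / 2) ^ 2 := by
    push_cast; ring
  rw [hcard, hbal] at hdet
  have hmul : (d * a) * (d * b) ≤ (d ^ r * (d + r * c)) * (d ^ t * (d + t * c)) :=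
    mul_le_mul hA1 hD1 (by positivity) hp.le
  have hF' : d ^ 2 * G.det ≤ (d * a) * (d * b) := by nlinarith [sq_nonneg d]
  have hsq : 0 ≤ d ^ (r + t) * (c * (r - t) / 2) ^ 2 := by positivity
  have hrt : (r : ℝ) = t := by
    have h0 : d ^ (r + t) * (c * ((r : ℝ) - t) / 2) ^ 2 = 0 := by linarith
    have h1 := pow_eq_zero_iff (two_ne_zero) |>.mp ((mul_eq_zero.mp h0).resolve_left hN.ne')
    have h2 : (r : ℝ) - t = 0 := by
      rcases mul_eq_zero.mp ((div_eq_zero_iff.mp h1).resolve_right two_ne_zero) with h | h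
      · exact absurd h hc.ne'
      · exact h
    linarith
  have hprod : (d * a) * (d * b) = (d ^ r * (d + r * c)) * (d ^ t * (d + t * c)) := by linarith
  have hGab : G.det = a * b := mul_left_cancel₀ (pow_ne_zero 2 hd.ne') (by linarith)
  have hAeq : d * a = d ^ r * (d + r * c) := by
    refine le_antisymm hA1 (le_of_mul_le_mul_right ?_ (mul_pos hd hDdet))
    rw [hprod]
    exact mul_le_mul_of_nonneg_left hD1 hp.le
  have hDeq : d * b = d ^ t * (d + t * c) :=
    mul_left_cancel₀ hp.ne' (by rw [← hprod, hAeq])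
  obtain ⟨s, hs, hsA⟩ := hA2 hAeq
  obtain ⟨s', hs', hsD⟩ := hD2 hDeq
  have hoff0 := hFeq hGab
  have hhalf : ((r + t : ℕ) : ℝ) / 2 = r := by push_cast; linarith
  refine ⟨fun i => if h : κ i then s ⟨i, h⟩ else 0, fun i => if h : κ i then 0 else s' ⟨i, h⟩,
    fun i => ?_, ?_, ?_, ?_⟩
  · by_cases h : κ i <;> simp [h, hs, hs']
  · rw [hcard, hhalf, hr, Fintype.card_subtype, dotProduct, Finset.card_filter, Nat.cast_sum]
    refine Finset.sum_congr rfl fun i _ => ?_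
    by_cases h : κ i <;> simp [h, ← sq, hs]
  · rw [hcard, hhalf, hrt, ht, Fintype.card_subtype, dotProduct, Finset.card_filter, Nat.cast_sum]
    refine Finset.sum_congr rfl fun i _ => ?_
    by_cases h : κ i <;> simp [h, ← sq, hs']
  · ext i j
    simp only [Matrix.add_apply, Matrix.smul_apply, vecMulVec_apply, smul_eq_mul]
    rcases eq_or_ne i j with rfl | hij
    · rw [hdiag, one_apply_eq]
      by_cases h : κ i <;> simp [h, ← sq, hs, hs']
    · rw [one_apply_ne hij]
      by_cases hi : κ i <;> by_cases hj : κ j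
      · simpa [hi, hj, toSquareBlockProp] using hsA ⟨i, hi⟩ ⟨j, hj⟩ (by simpa using hij)
      · simpa [hi, hj] using hoff0 i j (by simp [hi, hj])
      · simpa [hi, hj] using hoff0 i j (by simp [hi, hj])
      · simpa [hi, hj, toSquareBlockProp] using hsD ⟨i, hi⟩ ⟨j, hj⟩ (by simpa using hij)

lemma two_dvd_sum_sub_card {m : Type*} [Fintype m] {x : m → ℤ} (hx : ∀ k, x k = 1 ∨ x k = -1) :
    2 ∣ ∑ k, x k - Fintype.card m := by
  have h : ∑ k, x k - Fintype.card m = ∑ k, (x k - 1) := by simp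
  rw [h]
  refine Finset.dvd_sum fun k _ => ?_
  rcases hx k with h | h <;> rw [h] <;> norm_num

lemma four_dvd_dotProduct_sub {m : Type*} [Fintype m] {x y : m → ℤ}
    (hx : ∀ k, x k = 1 ∨ x k = -1) (hy : ∀ k, y k = 1 ∨ y k = -1) :
    4 ∣ x ⬝ᵥ y - (∑ k, x k + ∑ k, y k - Fintype.card m) := by
  have h : x ⬝ᵥ y - (∑ k, x k + ∑ k, y k - Fintype.card m) = ∑ k, (x k - 1) * (y k - 1) := by
    simp only [sub_mul, mul_sub, Finset.sum_sub_distrib, dotProduct]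
    simp
    ring
  rw [h]
  refine Finset.dvd_sum fun k _ => ?_
  rcases hx k with h | h <;> rcases hy k with h' | h' <;> rw [h, h'] <;> norm_num

/-- The Gram matrix of the rows of a matrix attaining the Ehlich–Wojtas bound. -/
lemma exists_gram_eq {n : ℕ} (hn : n % 4 = 2) (hn2 : 2 < n) {N : Matrix (Fin n) (Fin n) ℤ}
    (hN : ∀ i j, N i j = 1 ∨ N i j = -1)
    (hdet : |(N.map (Int.cast : ℤ → ℝ)).det| =
      (2 * (n : ℝ) - 2) * ((n : ℝ) - 2) ^ ((n - 2) / 2)) :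
    ∃ u w : Fin n → ℝ, (∀ i, u i ^ 2 = 1 ∧ w i = 0 ∨ u i = 0 ∧ w i ^ 2 = 1) ∧
      u ⬝ᵥ u = (n : ℝ) / 2 ∧ w ⬝ᵥ w = (n : ℝ) / 2 ∧
      N.map (Int.cast : ℤ → ℝ) * (N.map (Int.cast : ℤ → ℝ))ᵀ =
        ((n : ℝ) - 2) • 1 + (2 : ℝ) • (vecMulVec u u + vecMulVec w w) := by
  set M := N.map (Int.cast : ℤ → ℝ) with hM
  have hn2' : (2 : ℝ) < n := by exact_mod_cast hn2
  have hd : (0 : ℝ) < n - 2 := by linarith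
  have hpos : 0 < |M.det| := by
    rw [hdet]
    have : (0 : ℝ) < 2 * n - 2 := by linarith
    positivity
  have hMu : IsUnit M := (isUnit_iff_isUnit_det _).mpr (isUnit_iff_ne_zero.mpr (abs_pos.mp hpos))
  have hG : (M * Mᵀ).PosDef := by
    rw [← conjTranspose_eq_transpose_of_trivial]
    exact PosDef.mul_conjTranspose_self _ (vecMul_injective_of_isUnit hMu)
  have hentry : ∀ i j, (M * Mᵀ) i j = ((N i ⬝ᵥ N j : ℤ) : ℝ) := fun i j => by
    simp [mul_apply, dotProduct, hM]
  have hdetG : (n - 2 : ℝ) ^ 2 * (M * Mᵀ).det =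
      (n - 2 : ℝ) ^ Fintype.card (Fin n) * ((n - 2) + (Fintype.card (Fin n) : ℝ) / 2 * 2) ^ 2 := by
    have h1 : (n - 2) / 2 * 2 + 2 = n := by omega
    have h2 : (n - 2 : ℝ) ^ n = (((n : ℝ) - 2) ^ ((n - 2) / 2)) ^ 2 * (n - 2 : ℝ) ^ 2 := by
      rw [← pow_mul, ← pow_add, h1]
    rw [det_mul, det_transpose, ← abs_mul_abs_self, hdet, Fintype.card_fin, h2]
    ring
  have key := exists_two_block_of_det_eq two_pos hd hG (fun i => ?_)
    (fun i => (∑ k, N i k) % 4 = 0) (fun i j _ hij => ?_) hdetG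
  · simpa only [Fintype.card_fin] using key
  · have : N i ⬝ᵥ N i = n := by
      have h1 : ∀ k, N i k * N i k = 1 := fun k => by rcases hN i k with h | h <;> rw [h] <;> rfl
      simp [dotProduct, h1]
    rw [hentry, this]
    push_cast
    ring
  · have h1 := two_dvd_sum_sub_card (hN i)
    have h2 := two_dvd_sum_sub_card (hN j)
    have h3 := four_dvd_dotProduct_sub (hN i) (hN j)
    rw [Fintype.card_fin] at h1 h2 h3
    have h4 : 2 ≤ |N i ⬝ᵥ N j| := by
      rw [le_abs']
      omega
    rw [hentry]
    exact_mod_cast h4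

lemma mulVec_two_block (d : ℝ) (u w y : ι → ℝ) :
    (d • (1 : Matrix ι ι ℝ) + (2 : ℝ) • (vecMulVec u u + vecMulVec w w)) *ᵥ y =
      d • y + (2 * (u ⬝ᵥ y)) • u + (2 * (w ⬝ᵥ y)) • w := by
  ext i
  simp [add_mulVec, smul_mulVec, vecMulVec_mulVec]
  ring

end EhlichWojtas

/-- If an `n × n` `{±1}` matrix with `n ≡ 2 (mod 4)` attains the Ehlich–Wojtas
bound `|det M| = (2n-2)(n-2)^((n-2)/2)`, then `2n - 2` is a sum of two integer
squares. -/
theorem ehlich_wojtas_sum_two_squares (n : ℕ) (hn : n % 4 = 2)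
    (M : Matrix (Fin n) (Fin n) ℝ)
    (hM : ∀ i j, M i j = 1 ∨ M i j = -1)
    (hdet : |M.det| = (2 * (n : ℝ) - 2) * ((n : ℝ) - 2) ^ ((n - 2) / 2)) :
    ∃ a b : ℤ, a ^ 2 + b ^ 2 = 2 * (n : ℤ) - 2 := by
  rcases (show n = 2 ∨ 2 < n by omega) with rfl | hn2
  · exact ⟨1, 1, by norm_num⟩
  obtain ⟨N, hN, rfl⟩ : ∃ N : Matrix (Fin n) (Fin n) ℤ,
      (∀ i j, N i j = 1 ∨ N i j = -1) ∧ N.map (Int.cast : ℤ → ℝ) = M := by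
    refine ⟨of fun i j => if M i j = 1 then 1 else -1, fun i j => ?_, ?_⟩
    · simp only [of_apply]
      split_ifs <;> simp
    · ext i j
      rcases hM i j with h | h <;> norm_num [h]
  obtain ⟨u, w, huw, huu, hww, hG⟩ := EhlichWojtas.exists_gram_eq hn hn2 hN hdet
  obtain ⟨u', w', huw', huu', -, hG'⟩ := EhlichWojtas.exists_gram_eq hn hn2 (N := Nᵀ)
    (fun i j => hN j i) (by rwa [transpose_map, det_transpose])
  rw [transpose_map, transpose_transpose] at hG'
  set M := N.map (Int.cast : ℤ → ℝ) with hMdef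
  have hn0 : (0 : ℝ) < n / 2 := by
    have : (2 : ℝ) < n := by exact_mod_cast hn2
    linarith
  have hwu' : w' ⬝ᵥ u' = 0 := Finset.sum_eq_zero fun i _ => by
    rcases huw' i with ⟨-, h⟩ | ⟨h, -⟩ <;> simp [h]
  have hGu' : (Mᵀ * M) *ᵥ u' = (2 * n - 2 : ℝ) • u' := by
    rw [hG', EhlichWojtas.mulVec_two_block, huu', hwu']
    ext i
    simp
    ring
  set y := M *ᵥ u' with hy
  have hGy : (M * Mᵀ) *ᵥ y = (2 * n - 2 : ℝ) • y := by
    rw [hy, ← mulVec_smul, ← hGu', mulVec_mulVec, mulVec_mulVec, mul_assoc]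
  have hyi : ∀ i, (n / 2 : ℝ) * y i = (u ⬝ᵥ y) * u i + (w ⬝ᵥ y) * w i := fun i => by
    rw [hG, EhlichWojtas.mulVec_two_block] at hGy
    have := congrFun hGy i
    simp only [Pi.add_apply, Pi.smul_apply, smul_eq_mul] at this
    linarith
  have hyy : y ⬝ᵥ y = (2 * n - 2 : ℝ) * (n / 2) := by
    have h1 : y ⬝ᵥ y = u' ⬝ᵥ ((Mᵀ * M) *ᵥ u') := by
      rw [← mulVec_mulVec, dotProduct_mulVec u', vecMul_transpose]
    rw [h1, hGu', dotProduct_smul, huu', smul_eq_mul]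
  have hyint : ∀ i, ∃ a : ℤ, y i = a := fun i => by
    have hu'int : ∀ k, ∃ a : ℤ, u' k = a := fun k => by
      rcases huw' k with ⟨h, -⟩ | ⟨h, -⟩
      · rcases eq_or_eq_neg_of_sq_eq_sq (u' k) 1 (by rw [h, one_pow]) with h | h
        · exact ⟨1, by simp [h]⟩
        · exact ⟨-1, by simp [h]⟩
      · exact ⟨0, by simp [h]⟩
    choose z hz using hu'int
    exact ⟨∑ k, N i k * z k, by simp [hy, hMdef, mulVec, dotProduct, hz]⟩
  obtain ⟨i, hi⟩ : ∃ i, u i ≠ 0 := by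
    by_contra! h
    rw [show u = 0 from funext h, dotProduct_zero] at huu
    linarith
  obtain ⟨j, hj⟩ : ∃ j, w j ≠ 0 := by
    by_contra! h
    rw [show w = 0 from funext h, dotProduct_zero] at hww
    linarith
  obtain ⟨a, ha⟩ := hyint i
  obtain ⟨b, hb⟩ := hyint j
  have hα : ((n / 2 : ℝ) * a) ^ 2 = (u ⬝ᵥ y) ^ 2 := by
    obtain ⟨h1, h2⟩ := (huw i).resolve_right fun h => hi h.1
    rw [← ha, hyi, h2, mul_zero, add_zero, mul_pow, h1, mul_one]
  have hβ : ((n / 2 : ℝ) * b) ^ 2 = (w ⬝ᵥ y) ^ 2 := by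
    obtain ⟨h1, h2⟩ := (huw j).resolve_left fun h => hj h.2
    rw [← hb, hyi, h1, mul_zero, zero_add, mul_pow, h2, mul_one]
  have hsum : (n / 2 : ℝ) * (y ⬝ᵥ y) = (u ⬝ᵥ y) ^ 2 + (w ⬝ᵥ y) ^ 2 := by
    have h1 : (n / 2 : ℝ) • y = (u ⬝ᵥ y) • u + (w ⬝ᵥ y) • w := funext hyi
    rw [← smul_eq_mul, ← smul_dotProduct, h1, add_dotProduct, smul_dotProduct, smul_dotProduct,
      smul_eq_mul, smul_eq_mul, sq, sq]
  refine ⟨a, b, ?_⟩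
  have hfin : (a : ℝ) ^ 2 + (b : ℝ) ^ 2 = 2 * n - 2 := by
    have h2 : (n / 2 : ℝ) ^ 2 * ((a : ℝ) ^ 2 + (b : ℝ) ^ 2) = (n / 2 : ℝ) ^ 2 * (2 * n - 2) := by
      rw [hyy] at hsum
      linarith
    exact mul_left_cancel₀ (pow_pos hn0 2).ne' h2
  exact_mod_cast hfin
end

section
/- Let q be a prime with q ≡ 1 (mod 4), let Q be the Paley core of order q (which is symmetric since q ≡ 1 mod 4), and let j_q denote the all-ones column vector of length q. Then the (q+1) × (q+1) block matrix M = [[Q + I, −j_q], [j_qᵀ, 1]] is a {±1} matrix of order n = q+1 with |det(M)| = (q+1)·(q−1)^((q−1)/2) = n·(n−2)^((n−2)/2). -/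
open Matrix

section PaleyCore

variable {F : Type*} [Field F] [Fintype F] [DecidableEq F]

/-- The Paley core of a finite field. -/
def paleyCore (F : Type*) [Field F] [Fintype F] [DecidableEq F] : Matrix F F ℤ :=
  Matrix.of fun x y => quadraticChar F (x - y)

theorem det_scalar_add_const {R n : Type*} [CommRing R] [Fintype n] [DecidableEq n] (a b : R) :
    (a • (1 : Matrix n n R) + b • Matrix.of fun _ _ => 1).det =
      a ^ Fintype.card n + Fintype.card n * b * a ^ (Fintype.card n - 1) := by
  have h := congrArg (Polynomial.eval a)
    (charpoly_vecMulVec (fun _ : n => -b) (fun _ : n => (1 : R)))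
  rw [eval_charpoly] at h
  convert h using 1
  · congr 1
    ext i j
    simp [vecMulVec_apply, Matrix.one_apply, Matrix.diagonal_apply]
  · simp [dotProduct]

theorem sum_quadraticChar_mul_translate (hF : ringChar F ≠ 2) {x z : F} (h : x ≠ z) :
    ∑ y, quadraticChar F (x - y) * quadraticChar F (y - z) = -quadraticChar F (-1) := by
  have hd : x - z ≠ 0 := sub_ne_zero.mpr h
  have hJ := jacobiSum_nontrivial_inv (quadraticChar_ne_one hF)
  rw [(quadraticChar_isQuadratic F).inv, jacobiSum] at hJ
  rw [← hJ, ← ((Equiv.mulLeft₀ _ hd).trans (Equiv.addLeft z)).sum_comp]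
  refine Finset.sum_congr rfl fun t _ => ?_
  have h1 : x - (z + (x - z) * t) = (x - z) * (1 - t) := by ring
  have h2 : z + (x - z) * t - z = (x - z) * t := by ring
  simp only [Equiv.trans_apply, Equiv.mulLeft₀_apply, Equiv.coe_addLeft, h1, h2, map_mul]
  linear_combination
    quadraticChar F (1 - t) * quadraticChar F t * quadraticChar_sq_one hd

theorem paleyCore_mul_self (hF : ringChar F ≠ 2) (hneg : quadraticChar F (-1) = 1) :
    paleyCore F * paleyCore F =
      (Fintype.card F : ℤ) • (1 : Matrix F F ℤ) - Matrix.of fun _ _ => 1 := by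
  ext x z
  rw [Matrix.mul_apply]
  simp only [paleyCore, of_apply, Matrix.sub_apply, Matrix.smul_apply, smul_eq_mul]
  by_cases h : x = z
  · subst h
    have hterm : ∀ y, quadraticChar F (x - y) * quadraticChar F (y - x) =
        1 - if x = y then 1 else 0 := by
      intro y
      split_ifs with hxy
      · simp [hxy]
      · rw [← neg_sub x y, ← neg_one_mul, map_mul, hneg, one_mul, ← sq,
          quadraticChar_sq_one (sub_ne_zero.mpr hxy), sub_zero]
    rw [Finset.sum_congr rfl fun y _ => hterm y]
    simp
  · rw [sum_quadraticChar_mul_translate hF h, hneg, one_apply_ne h]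
    ring

theorem paleyCore_mul_const (hF : ringChar F ≠ 2) :
    paleyCore F * (Matrix.of fun _ _ => 1) = 0 := by
  ext x z
  simp only [paleyCore, Matrix.mul_apply, of_apply, mul_one, Matrix.zero_apply]
  rw [← quadraticChar_sum_zero hF]
  exact (Equiv.subLeft x).sum_comp (quadraticChar F)

theorem const_mul_paleyCore (hF : ringChar F ≠ 2) :
    (Matrix.of fun _ _ => 1) * paleyCore F = 0 := by
  ext x z
  simp only [paleyCore, Matrix.mul_apply, of_apply, one_mul, Matrix.zero_apply]
  rw [← quadraticChar_sum_zero hF]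
  exact (Equiv.subRight z).sum_comp (quadraticChar F)

/-- Multiplication by a nonsquare conjugates the Paley core to its negative. -/
theorem det_one_sub_paleyCore_add_const (hF : ringChar F ≠ 2) :
    (1 - paleyCore F + Matrix.of fun _ _ => 1).det =
      (1 + paleyCore F + Matrix.of fun _ _ => 1).det := by
  obtain ⟨c, hc⟩ := quadraticChar_exists_neg_one' hF
  rw [← det_submatrix_equiv_self (Equiv.mulLeft₀ (c : F) c.ne_zero) (1 + _ + _)]
  congr 1
  ext x y
  have h : quadraticChar F (c * x - c * y) = -quadraticChar F (x - y) := by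
    rw [← mul_sub, map_mul, hc, neg_one_mul]
  simp only [paleyCore, submatrix_apply, Matrix.add_apply, Matrix.sub_apply, of_apply,
    Equiv.mulLeft₀_apply, h, Matrix.one_apply, mul_right_inj' c.ne_zero]
  ring

theorem abs_det_one_add_paleyCore_add_const (hneg : quadraticChar F (-1) = 1)
    (hodd : Fintype.card F % 2 = 1) :
    |(1 + paleyCore F + Matrix.of fun _ _ => 1).det| =
      ((Fintype.card F : ℤ) + 1) * ((Fintype.card F : ℤ) - 1) ^ ((Fintype.card F - 1) / 2) := by
  have hF : ringChar F ≠ 2 := fun h => by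
    have := FiniteField.even_card_of_char_two h
    omega
  set J : Matrix F F ℤ := Matrix.of fun _ _ => 1 with hJ
  have hJJ : J * J = (Fintype.card F : ℤ) • J := by
    ext x y
    simp [hJ, Matrix.mul_apply]
  have hprod : (1 + paleyCore F + J) * (1 - paleyCore F + J) =
      (1 - Fintype.card F : ℤ) • (1 : Matrix F F ℤ) + (Fintype.card F + 3 : ℤ) • J := by
    have hexp : (1 + paleyCore F + J) * (1 - paleyCore F + J) =
        1 - paleyCore F * paleyCore F + paleyCore F * J - J * paleyCore F + J + J + J * J := by
      noncomm_ring
    rw [hexp, paleyCore_mul_self hF hneg, paleyCore_mul_const hF, const_mul_paleyCore hF, hJJ]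
    module
  have hdet := congrArg Matrix.det hprod
  rw [det_mul, det_one_sub_paleyCore_add_const hF, det_scalar_add_const] at hdet
  obtain ⟨k, hk⟩ : ∃ k, Fintype.card F = 2 * k + 1 := ⟨Fintype.card F / 2, by omega⟩
  have hnonneg : (0 : ℤ) ≤ ((Fintype.card F : ℤ) + 1) *
      ((Fintype.card F : ℤ) - 1) ^ ((Fintype.card F - 1) / 2) := by
    have : (0 : ℤ) ≤ (Fintype.card F : ℤ) - 1 := by omega
    positivity
  rw [← abs_of_nonneg hnonneg, ← sq_eq_sq_iff_abs_eq_abs, sq, hdet, hk]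
  have h1 : (2 * k + 1 - 1) / 2 = k := by omega
  have h2 : (1 - ((2 * k + 1 : ℕ) : ℤ)) ^ (2 * k) = (((2 * k + 1 : ℕ) : ℤ) - 1) ^ (2 * k) := by
    rw [← neg_sub, (even_two_mul k).neg_pow]
  rw [h1, Nat.add_sub_cancel, pow_succ, h2]
  ring

end PaleyCore

/-- Cohn's construction: for a prime `q ≡ 1 (mod 4)`, bordering the Paley core
`Q` as `M = [[Q + I, -j], [jᵀ, 1]]` gives a `{±1}` matrix of order `n = q + 1`
with `|det M| = (q+1)(q-1)^((q-1)/2) = n(n-2)^((n-2)/2)`. -/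
theorem cohn_construction (q : ℕ) [Fact q.Prime] (hq : q % 4 = 1)
    (Q : Matrix (ZMod q) (ZMod q) ℤ)
    (hQ : ∀ x y, Q x y = quadraticChar (ZMod q) (x - y))
    (M : Matrix (ZMod q ⊕ Unit) (ZMod q ⊕ Unit) ℤ)
    (hM : M = Matrix.fromBlocks (Q + 1)
      (Matrix.of fun _ _ => -1) (Matrix.of fun _ _ => 1) 1) :
    (∀ i j, M i j = 1 ∨ M i j = -1) ∧
    |M.det| = ((q : ℤ) + 1) * ((q : ℤ) - 1) ^ ((q - 1) / 2) := by
  have hcard : Fintype.card (ZMod q) = q := ZMod.card q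
  have hF : ringChar (ZMod q) ≠ 2 := by
    rw [ZMod.ringChar_zmod_n]
    omega
  have hneg : quadraticChar (ZMod q) (-1) = 1 := by
    rw [quadraticChar_neg_one hF, hcard, ZMod.χ₄_nat_one_mod_four hq]
  obtain rfl : Q = paleyCore (ZMod q) := by
    ext x y
    exact hQ x y
  subst hM
  refine ⟨?_, ?_⟩
  · rintro (x | x) (y | y)
    · by_cases h : x = y
      · simp [paleyCore, h]
      · simpa [paleyCore, one_apply_ne h] using quadraticChar_dichotomy (sub_ne_zero.mpr h)
    · simp
    · simp
    · simp
  · have h := abs_det_one_add_paleyCore_add_const hneg (by omega)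
    rw [hcard] at h
    rw [← h, det_fromBlocks_one₂₂]
    congr 2
    ext x y
    simp [Matrix.mul_apply, add_comm]
end

section
/- Fix an integer n ≥ 7 with n ≡ 3 (mod 4). For 1 ≤ m ≤ n, let 𝒞ₘ be the (finite, nonempty) set of symmetric m × m integer matrices C with all diagonal entries equal to n, all off-diagonal entries congruent to 3 modulo 4, and all off-diagonal entries of absolute value strictly less than n; let γₘ be the maximum of det(C) over C ∈ 𝒞ₘ. Then for all 1 ≤ m ≤ n−1, γ_{m+1} > (n−3)·γₘ. -/
open Matrix

/-- For a fixed `n ≡ 3 (mod 4)`, the set `𝒞ₘ` of symmetric `m × m` integer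
matrices with diagonal entries `n`, off-diagonal entries `≡ 3 (mod 4)` of
absolute value strictly less than `n`. -/
def ehlichClass (n m : ℕ) : Set (Matrix (Fin m) (Fin m) ℤ) :=
  {C | Cᵀ = C ∧ (∀ i, C i i = (n : ℤ)) ∧
    ∀ i j, i ≠ j → C i j % 4 = 3 ∧ |C i j| < (n : ℤ)}

section DuplicateIndex

variable {R : Type*} {k : ℕ}

/-- Duplicate the index `0` of `C`, placing `a` in the two positions that pair the index `0`
with its copy. -/
def duplicateZero (C : Matrix (Fin (k + 1)) (Fin (k + 1)) R) (a : R) :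
    Matrix (Fin (k + 2)) (Fin (k + 2)) R :=
  Matrix.of (Fin.cons (Fin.cons (C 0 0) (Fin.cons a fun j => C 0 j.succ))
    fun i => Fin.cons ((C.updateRow 0 (Function.update (C 0) 0 a)) i 0) (C i))

theorem duplicateZero_zero_zero (C : Matrix (Fin (k + 1)) (Fin (k + 1)) R) (a : R) :
    duplicateZero C a 0 0 = C 0 0 := rfl

theorem duplicateZero_zero_one (C : Matrix (Fin (k + 1)) (Fin (k + 1)) R) (a : R) :
    duplicateZero C a 0 (Fin.succ 0) = a := rfl

theorem duplicateZero_zero_succ_succ (C : Matrix (Fin (k + 1)) (Fin (k + 1)) R) (a : R)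
    (j : Fin k) : duplicateZero C a 0 j.succ.succ = C 0 j.succ := rfl

theorem duplicateZero_one_zero (C : Matrix (Fin (k + 1)) (Fin (k + 1)) R) (a : R) :
    duplicateZero C a (Fin.succ 0) 0 = a := by
  simp [duplicateZero]

theorem duplicateZero_succ_succ_zero (C : Matrix (Fin (k + 1)) (Fin (k + 1)) R) (a : R)
    (i : Fin k) : duplicateZero C a i.succ.succ 0 = C i.succ 0 := by
  simp [duplicateZero]

theorem duplicateZero_succ_succ (C : Matrix (Fin (k + 1)) (Fin (k + 1)) R) (a : R)
    (i j : Fin (k + 1)) : duplicateZero C a i.succ j.succ = C i j := rfl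

variable [CommRing R]

theorem det_updateRow_zero_update_zero (C : Matrix (Fin (k + 1)) (Fin (k + 1)) R) (a : R) :
    (C.updateRow 0 (Function.update (C 0) 0 a)).det =
      C.det - (C 0 0 - a) * (C.submatrix Fin.succ Fin.succ).det := by
  have hsub : ∀ f : Fin k → Fin (k + 1),
      (C.updateRow 0 (Function.update (C 0) 0 a)).submatrix Fin.succ f =
        C.submatrix Fin.succ f := by
    intro f
    ext i j
    simp [Matrix.updateRow_apply]
  rw [Matrix.det_succ_row_zero, Matrix.det_succ_row_zero C, Fin.sum_univ_succ,
    Fin.sum_univ_succ]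
  simp only [hsub, Matrix.updateRow_self, Function.update_self,
    Function.update_of_ne (Fin.succ_ne_zero _)]
  simp only [Fin.val_zero, pow_zero, one_mul, Fin.succAbove_zero]
  ring

theorem det_duplicateZero (C : Matrix (Fin (k + 1)) (Fin (k + 1)) R) (a : R) :
    (duplicateZero C a).det = (C 0 0 - a) *
      (2 * C.det - (C 0 0 - a) * (C.submatrix Fin.succ Fin.succ).det) := by
  have hrow : (duplicateZero C a) 0 + (-1 : R) • (duplicateZero C a) (Fin.succ 0) =
      Fin.cons (C 0 0 - a) (Fin.cons (a - C 0 0) fun _ => 0) := by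
    ext j
    refine Fin.cases ?_ (fun j => Fin.cases ?_ (fun j => ?_) j) j <;>
      simp only [Pi.add_apply, Pi.smul_apply, smul_eq_mul, Fin.cons_zero, Fin.cons_succ,
        duplicateZero_zero_zero, duplicateZero_zero_one, duplicateZero_zero_succ_succ,
        duplicateZero_one_zero, duplicateZero_succ_succ] <;>
      ring
  have hleft : ((duplicateZero C a).updateRow 0 (Fin.cons (C 0 0 - a)
      (Fin.cons (a - C 0 0) fun _ => 0))).submatrix Fin.succ (Fin.succAbove 0) = C := by
    ext i j
    simp [duplicateZero, Matrix.updateRow_apply]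
  have hright : ((duplicateZero C a).updateRow 0 (Fin.cons (C 0 0 - a)
      (Fin.cons (a - C 0 0) fun _ => 0))).submatrix Fin.succ
        (Fin.succAbove (Fin.succ 0)) = C.updateRow 0 (Function.update (C 0) 0 a) := by
    ext i j
    refine Fin.cases ?_ (fun j => ?_) j
    · simp [duplicateZero, Matrix.updateRow_apply]
    · by_cases hi : i = 0 <;>
        simp [duplicateZero, Matrix.updateRow_apply, hi]
  rw [← Matrix.det_updateRow_add_smul_self (duplicateZero C a)
    (Fin.succ_ne_zero 0).symm (-1), hrow, Matrix.det_succ_row_zero,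
    Fin.sum_univ_succ, Fin.sum_univ_succ, hleft, hright, det_updateRow_zero_update_zero]
  simp only [Matrix.updateRow_self, Fin.cons_zero, Fin.cons_succ, Fin.val_zero, Fin.val_succ,
    mul_zero, zero_mul, Finset.sum_const_zero]
  ring

end DuplicateIndex

theorem submatrix_succ_mem_ehlichClass {n k : ℕ} {C : Matrix (Fin (k + 1)) (Fin (k + 1)) ℤ}
    (hC : C ∈ ehlichClass n (k + 1)) : C.submatrix Fin.succ Fin.succ ∈ ehlichClass n k := by
  obtain ⟨hsymm, hdiag, hoff⟩ := hC
  refine ⟨?_, fun i => hdiag _, fun i j hij => hoff _ _ (by simpa using hij)⟩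
  rw [Matrix.transpose_submatrix, hsymm]

theorem duplicateZero_mem_ehlichClass {n k : ℕ} (hn : 3 < n)
    {C : Matrix (Fin (k + 1)) (Fin (k + 1)) ℤ} (hC : C ∈ ehlichClass n (k + 1)) :
    duplicateZero C 3 ∈ ehlichClass n (k + 2) := by
  obtain ⟨hsymm, hdiag, hoff⟩ := hC
  have hcomm : ∀ i j, C i j = C j i := fun i j => congrFun (congrFun hsymm j) i
  have habs : |(3 : ℤ)| < n := by
    rw [abs_of_pos (by norm_num)]
    exact_mod_cast hn
  refine ⟨?_, ?_, ?_⟩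
  · ext i j
    refine Fin.cases ?_ (fun i => Fin.cases ?_ (fun i => ?_) i) i <;>
      refine Fin.cases ?_ (fun j => Fin.cases ?_ (fun j => ?_) j) j <;>
      simp only [Matrix.transpose_apply, duplicateZero_zero_zero, duplicateZero_zero_one,
        duplicateZero_zero_succ_succ, duplicateZero_one_zero, duplicateZero_succ_succ_zero,
        duplicateZero_succ_succ] <;>
      exact hcomm _ _
  · intro i
    refine Fin.cases ?_ (fun i => ?_) i <;> simp [duplicateZero, hdiag]
  · intro i j
    refine Fin.cases ?_ (fun i => Fin.cases ?_ (fun i => ?_) i) i <;>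
      refine Fin.cases ?_ (fun j => Fin.cases ?_ (fun j => ?_) j) j <;>
      intro hij <;>
      simp only [duplicateZero_zero_zero, duplicateZero_zero_one,
        duplicateZero_zero_succ_succ, duplicateZero_one_zero, duplicateZero_succ_succ_zero,
        duplicateZero_succ_succ] <;>
      first
      | exact absurd rfl hij
      | exact ⟨rfl, habs⟩
      | exact hoff _ _ (Fin.succ_ne_zero _)
      | exact hoff _ _ (Fin.succ_ne_zero _).symm
      | exact hoff _ _ fun h => hij (congrArg Fin.succ h)

theorem ehlichClass_finite (n m : ℕ) : (ehlichClass n m).Finite := by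
  refine (Set.finite_Icc (fun _ _ => -(n : ℤ) : Fin m → Fin m → ℤ) (fun _ _ => n)).subset ?_
  rintro C ⟨-, hdiag, hoff⟩
  have habs : ∀ i j, |C i j| ≤ (n : ℤ) := by
    intro i j
    by_cases hij : i = j
    · rw [hij, hdiag, Nat.abs_cast]
    · exact (hoff i j hij).2.le
  exact ⟨fun i j => (abs_le.mp (habs i j)).1, fun i j => (abs_le.mp (habs i j)).2⟩

/-- Every member of `𝒞ₘ` has determinant less than `1 / (n - 3)` times that of some member of
`𝒞ₘ₊₁`. -/
theorem exists_mem_ehlichClass_succ_det_gt {n : ℕ} (hn : 3 < n) (m : ℕ)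
    {C : Matrix (Fin m) (Fin m) ℤ} (hC : C ∈ ehlichClass n m) :
    ∃ D ∈ ehlichClass n (m + 1), ((n : ℤ) - 3) * C.det < D.det := by
  have hpos : (0 : ℤ) < (n : ℤ) - 3 := by omega
  induction m with
  | zero =>
    refine ⟨Matrix.of fun _ _ => (n : ℤ), ⟨rfl, fun _ => rfl, fun i j hij => ?_⟩, ?_⟩
    · exact absurd (Subsingleton.elim (α := Fin 1) i j) hij
    · simp
  | succ k ih =>
    obtain ⟨B, hB, hmax⟩ :=
      (ehlichClass n (k + 1)).exists_max_image Matrix.det (ehlichClass_finite n (k + 1)) ⟨C, hC⟩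
    obtain ⟨D, hD, hlt⟩ := ih (submatrix_succ_mem_ehlichClass hB)
    refine ⟨duplicateZero B 3, duplicateZero_mem_ehlichClass hn hB, ?_⟩
    rw [det_duplicateZero, hB.2.1 0]
    exact mul_lt_mul_of_pos_left (by linarith [hmax C hC, hmax D hD]) hpos

/-- Growth of the maximal determinants `γₘ` of the classes `𝒞ₘ`:
for `1 ≤ m ≤ n - 1`, `γ_{m+1} > (n - 3) γₘ`. -/
theorem ehlich_gamma_growth (n : ℕ) (hn : 7 ≤ n) (hn4 : n % 4 = 3)
    (m : ℕ) (hm1 : 1 ≤ m) (hm2 : m ≤ n - 1)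
    (γm γm1 : ℤ)
    (hγm : IsGreatest (Matrix.det '' ehlichClass n m) γm)
    (hγm1 : IsGreatest (Matrix.det '' ehlichClass n (m + 1)) γm1) :
    ((n : ℤ) - 3) * γm < γm1 := by
  obtain ⟨C, hC, rfl⟩ := hγm.1
  obtain ⟨D, hD, hlt⟩ := exists_mem_ehlichClass_succ_det_gt (by omega) m hC
  exact hlt.trans_le (hγm1.2 ⟨D, hD, rfl⟩)
end

section
/- Let k ≥ 2 and let R and S be k × k {±1} matrices and r, s integers satisfying R·J = J·R = r·J, S·J = J·S = s·J, R·Rᵀ + S·Sᵀ = (2k−2)·I + 2·J, and R·Sᵀ = S·Rᵀ, where I and J are the k × k identity and all-ones matrices. Let j_k be the all-ones row vector of length k, and let M be the (2k+1) × (2k+1) block matrix M = [[R, S, j_kᵀ], [S, −R, −j_kᵀ], [j_k, j_k, 1]]. Then det(M·Mᵀ) = (4k²r² − 16k²r + 16k² − 16k + 8kr + 4) · (2k−2)^(2k−2). -/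
open Matrix

/-- The `k × k` all-ones integer matrix. -/
def allOnes (k : ℕ) : Matrix (Fin k) (Fin k) ℤ :=
  Matrix.of fun _ _ => 1

/-- Determinant of a scalar matrix plus a matrix which is constant on the blocks determined by `f`:
it reduces to a determinant indexed by the blocks. -/
theorem det_smul_one_add_submatrix {R n p : Type*} [CommRing R] [Fintype n] [DecidableEq n]
    [Fintype p] [DecidableEq p] (t : R) (f : n → p) (C : Matrix p p R) :
    t ^ Fintype.card p * (t • (1 : Matrix n n R) + C.submatrix f f).det
      = t ^ Fintype.card n *
        (t • (1 : Matrix p p R)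
          + C * diagonal fun q => ((Fintype.card {x // f x = q} : ℕ) : R)).det := by
  have h := congrArg (Polynomial.eval t)
    (charpoly_mul_comm' ((1 : Matrix p p R).submatrix f id) (-C.submatrix id f))
  have hAB : (1 : Matrix p p R).submatrix f id * (-C.submatrix id f) = -C.submatrix f f := by
    ext x y
    simp [mul_apply, one_apply]
  have hBA : (-C.submatrix id f) * (1 : Matrix p p R).submatrix f id
      = -(C * diagonal fun q => ((Fintype.card {x // f x = q} : ℕ) : R)) := by
    ext a q
    simp [mul_apply, one_apply, diagonal_apply, Fintype.card_subtype, Finset.sum_ite]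
    rw [Finset.sum_congr rfl (g := fun _ => C a q)
      (fun x hx => by rw [(Finset.mem_filter.mp hx).2])]
    simp [mul_comm]
  rw [hAB, hBA] at h
  simpa only [Polynomial.eval_mul, Polynomial.eval_pow, Polynomial.eval_X, eval_charpoly,
    sub_neg_eq_add, scalar_apply, ← smul_one_eq_diagonal] using h

theorem row_sum_of_mul_allOnes {k : ℕ} {A : Matrix (Fin k) (Fin k) ℤ} {a : ℤ}
    (h : A * allOnes k = a • allOnes k) (i : Fin k) : ∑ j, A i j = a := by
  simpa [mul_apply, allOnes] using congrFun (congrFun h i) i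

theorem col_sum_of_allOnes_mul {k : ℕ} {A : Matrix (Fin k) (Fin k) ℤ} {a : ℤ}
    (h : allOnes k * A = a • allOnes k) (j : Fin k) : ∑ i, A i j = a := by
  simpa [mul_apply, allOnes] using congrFun (congrFun h j) j

theorem sum_mul_row {k : ℕ} {A : Matrix (Fin k) (Fin k) ℤ} {a : ℤ}
    (hr : A * allOnes k = a • allOnes k) (hc : allOnes k * A = a • allOnes k) (i : Fin k) :
    ∑ j, (A * Aᵀ) i j = a ^ 2 := by
  simp only [mul_apply, transpose_apply]
  rw [Finset.sum_comm]
  simp only [← Finset.mul_sum, col_sum_of_allOnes_mul hc, ← Finset.sum_mul,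
    row_sum_of_mul_allOnes hr, sq]

/-- The block containing an index of the bordered matrix. -/
def borderedBlock (k : ℕ) : (Fin k ⊕ Fin k) ⊕ Unit → Fin 3 :=
  Sum.elim (Sum.elim (fun _ => 0) fun _ => 1) fun _ => 2

/-- Bordering construction for `n ≡ 3 (mod 4)`: if `R, S` are `k × k` `{±1}`
matrices with constant row and column sums `r, s`, satisfying
`R·Rᵀ + S·Sᵀ = (2k-2)·I + 2·J` and `R·Sᵀ = S·Rᵀ`, then the
`(2k+1) × (2k+1)` block matrix `M = [[R, S, j_kᵀ], [S, -R, -j_kᵀ], [j_k, j_k, 1]]`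
satisfies `det(M·Mᵀ) = (4k²r² - 16k²r + 16k² - 16k + 8kr + 4)(2k-2)^(2k-2)`. -/
theorem bordered_three_mod_four_det (k : ℕ) (hk : 2 ≤ k)
    (R S : Matrix (Fin k) (Fin k) ℤ) (r s : ℤ)
    (hR : ∀ i j, R i j = 1 ∨ R i j = -1)
    (hS : ∀ i j, S i j = 1 ∨ S i j = -1)
    (hRJ : R * allOnes k = r • allOnes k)
    (hJR : allOnes k * R = r • allOnes k)
    (hSJ : S * allOnes k = s • allOnes k)
    (hJS : allOnes k * S = s • allOnes k)
    (hGram : R * Rᵀ + S * Sᵀ = (2 * (k : ℤ) - 2) • 1 + (2 : ℤ) • allOnes k)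
    (hRS : R * Sᵀ = S * Rᵀ)
    (M : Matrix ((Fin k ⊕ Fin k) ⊕ Unit) ((Fin k ⊕ Fin k) ⊕ Unit) ℤ)
    (hM : M = Matrix.fromBlocks
      (Matrix.fromBlocks R S S (-R))
      (Matrix.of fun i _ => Sum.elim (fun _ => (1 : ℤ)) (fun _ => (-1 : ℤ)) i)
      (Matrix.of fun _ _ => (1 : ℤ))
      (1 : Matrix Unit Unit ℤ)) :
    (M * Mᵀ).det
      = (4 * (k : ℤ) ^ 2 * r ^ 2 - 16 * (k : ℤ) ^ 2 * r + 16 * (k : ℤ) ^ 2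
          - 16 * (k : ℤ) + 8 * (k : ℤ) * r + 4) * (2 * (k : ℤ) - 2) ^ (2 * k - 2) := by
  have hrs : r ^ 2 + s ^ 2 = 4 * (k : ℤ) - 2 := by
    have i : Fin k := ⟨0, by lia⟩
    rw [← sum_mul_row hRJ hJR i, ← sum_mul_row hSJ hJS i, ← Finset.sum_add_distrib]
    simp only [← Matrix.add_apply, hGram]
    simp only [Matrix.add_apply, Matrix.smul_apply, smul_eq_mul, one_apply]
    simp [allOnes, Finset.sum_add_distrib]
    ring
  have hG : M * Mᵀ = (2 * (k : ℤ) - 2) • 1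
      + (!![3, -1, r + s + 1; -1, 3, s - r - 1; r + s + 1, s - r - 1, 3] :
          Matrix (Fin 3) (Fin 3) ℤ).submatrix (borderedBlock k) (borderedBlock k) := by
    have hg (i j) := congrFun (congrFun hGram i) j
    have hx (i j) := congrFun (congrFun hRS i) j
    have hR' := row_sum_of_mul_allOnes hRJ
    have hS' := row_sum_of_mul_allOnes hSJ
    simp only [mul_apply, transpose_apply, Matrix.add_apply, Matrix.smul_apply, allOnes,
      of_apply, smul_eq_mul, one_apply, mul_ite, mul_one, mul_zero] at hg hx
    ext ((i | i) | i) ((j | j) | j) <;>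
      simp only [Matrix.add_apply, Matrix.smul_apply, smul_eq_mul, one_apply] <;>
      simp [hM, mul_apply, borderedBlock, hR', hS'] <;>
      first
        | linarith [hg i j, hx i j]
        | ring
  have hc0 : Fintype.card {x // borderedBlock k x = 0} = k := by
    rw [Fintype.card_subtype, Finset.card_filter]
    simp [borderedBlock]
  have hc1 : Fintype.card {x // borderedBlock k x = 1} = k := by
    rw [Fintype.card_subtype, Finset.card_filter]
    simp [borderedBlock]
  have hc2 : Fintype.card {x // borderedBlock k x = 2} = 1 := by
    rw [Fintype.card_subtype, Finset.card_filter]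
    simp [borderedBlock]
  have hdet := det_smul_one_add_submatrix (2 * (k : ℤ) - 2) (borderedBlock k)
    !![3, -1, r + s + 1; -1, 3, s - r - 1; r + s + 1, s - r - 1, 3]
  have hcard : Fintype.card ((Fin k ⊕ Fin k) ⊕ Unit) = 3 + (2 * k - 2) := by
    simp
    lia
  rw [← hG, hcard, Fintype.card_fin, pow_add, mul_assoc] at hdet
  have hm : (2 * (k : ℤ) - 2) ^ 3 ≠ 0 := pow_ne_zero _ (by lia)
  rw [mul_left_cancel₀ hm hdet, mul_comm]
  congr 1
  simp only [det_fin_three, Matrix.add_apply, Matrix.smul_apply, smul_eq_mul, one_apply]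
  simp [ mul_apply, diagonal_apply, hc0, hc1, hc2]
  linear_combination (-12 * (k : ℤ) ^ 2 + 4 * k) * hrs
end
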